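/- (Rank-one theorem in BD.) Let Ω ⊂ ℝ^d be an open set and let u ∈ BD(Ω). Then for |E^s u|-almost every x ∈ Ω there exist a(x), b(x) ∈ ℝ^d ∖ {0} such that d(E^s u)/d|E^s u|(x) = a(x) ⊙ b(x), where a ⊙ b := (a⊗b + b⊗a)/2 denotes the symmetrized tensor product. -/

import Mathlib

open MeasureTheory Metric

/-- The partial derivative `∂_j φ` of a scalar function on `ℝ^d`. -/
noncomputable def pderiv' {d : ℕ} (j : Fin d) (φ : EuclideanSpace ℝ (Fin d) → ℝ) :
    EuclideanSpace ℝ (Fin d) → ℝ :=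
  fun x => fderiv ℝ φ x (EuclideanSpace.single j 1)

namespace BDRankOne

open Set Filter Topology
open scoped ContDiff Convolution

section Directional

variable {E : Type*} [NormedAddCommGroup E] [NormedSpace ℝ E]

/-- The derivative of `φ` in the direction `v`. -/
noncomputable def dd (v : E) (φ : E → ℝ) : E → ℝ := fun x => fderiv ℝ φ x v

/-- Smooth functions with compact support. -/
def IsTest (φ : E → ℝ) : Prop := ContDiff ℝ ∞ φ ∧ HasCompactSupport φ

lemma contDiff_dd {φ : E → ℝ} (h : ContDiff ℝ ∞ φ) (v : E) : ContDiff ℝ ∞ (dd v φ) := by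
  unfold dd
  exact (h.fderiv_right (m := ∞) (by simp)).clm_apply contDiff_const

lemma differentiable_of_smooth {φ : E → ℝ} (h : ContDiff ℝ ∞ φ) : Differentiable ℝ φ :=
  h.differentiable (by simp)

lemma tsupport_dd_subset (v : E) (φ : E → ℝ) : tsupport (dd v φ) ⊆ tsupport φ :=
  (closure_mono fun x hx => by
    contrapose! hx
    simp only [Function.mem_support, dd, not_not]
    rw [Function.notMem_support] at hx
    simp [hx]).trans (tsupport_fderiv_subset ℝ (f := φ))

lemma IsTest.dd {φ : E → ℝ} (h : IsTest φ) (v : E) : IsTest (dd v φ) :=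
  ⟨contDiff_dd h.1 v, h.2.of_isClosed_subset (isClosed_tsupport _) (tsupport_dd_subset v φ)⟩

lemma IsTest.continuous {φ : E → ℝ} (h : IsTest φ) : Continuous φ := h.1.continuous

lemma IsTest.add {φ ψ : E → ℝ} (h : IsTest φ) (h' : IsTest ψ) : IsTest (fun x => φ x + ψ x) :=
  ⟨h.1.add h'.1, h.2.add h'.2⟩

lemma IsTest.sub {φ ψ : E → ℝ} (h : IsTest φ) (h' : IsTest ψ) : IsTest (fun x => φ x - ψ x) :=
  ⟨h.1.sub h'.1, h.2.sub h'.2⟩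

lemma IsTest.sum {ι : Type*} (s : Finset ι) {φ : ι → E → ℝ} (h : ∀ i, IsTest (φ i)) :
    IsTest (fun x => ∑ i ∈ s, φ i x) := by
  classical
  induction s using Finset.induction_on with
  | empty => exact ⟨by simpa using contDiff_const, by
      simpa using! (HasCompactSupport.zero : HasCompactSupport (0 : E → ℝ))⟩
  | insert a s ha ih => simpa [Finset.sum_insert ha] using (h a).add ih

lemma IsTest.mul {φ ψ : E → ℝ} (h : IsTest φ) (h' : ContDiff ℝ ∞ ψ) :
    IsTest (fun x => φ x * ψ x) :=
  ⟨h.1.mul h', h.2.mul_right⟩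

lemma IsTest.mul' {φ ψ : E → ℝ} (h : ContDiff ℝ ∞ φ) (h' : IsTest ψ) :
    IsTest (fun x => φ x * ψ x) :=
  ⟨h.mul h'.1, h'.2.mul_left⟩

lemma IsTest.exists_bound {φ : E → ℝ} (h : IsTest φ) : ∃ C, 0 ≤ C ∧ ∀ x, |φ x| ≤ C := by
  obtain ⟨C, hC⟩ := h.2.exists_bound_of_continuous h.continuous
  exact ⟨max C 0, le_max_right _ _, fun x => (hC x).trans (le_max_left _ _)⟩

lemma IsTest.integrable [MeasurableSpace E] [OpensMeasurableSpace E]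
    {φ : E → ℝ} (h : IsTest φ) (m : Measure E) [IsFiniteMeasureOnCompacts m] : Integrable φ m :=
  h.continuous.integrable_of_hasCompactSupport h.2

lemma dd_comm {φ : E → ℝ} (h : ContDiff ℝ ∞ φ) (v w : E) : dd v (dd w φ) = dd w (dd v φ) := by
  funext x
  have h2 : DifferentiableAt ℝ (fderiv ℝ φ) x :=
    (h.fderiv_right (m := ∞) (by simp)).differentiable (by simp) x
  have hs : IsSymmSndFDerivAt ℝ φ x := h.contDiffAt.isSymmSndFDerivAt
    (by simpa using ENat.LEInfty.out)
  have key : ∀ a b : E, dd a (dd b φ) x = fderiv ℝ (fderiv ℝ φ) x a b := by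
    intro a b
    unfold dd
    rw [fderiv_clm_apply h2 (by fun_prop)]
    simp
  rw [key, key, hs]

lemma dd_mul {φ ψ : E → ℝ} (h : ContDiff ℝ ∞ φ) (h' : ContDiff ℝ ∞ ψ) (v : E) :
    dd v (fun x => φ x * ψ x) = fun x => φ x * dd v ψ x + dd v φ x * ψ x := by
  funext x
  unfold dd
  rw [fderiv_fun_mul (differentiable_of_smooth h x) (differentiable_of_smooth h' x)]
  simp
  ring

lemma dd_add {φ ψ : E → ℝ} (h : ContDiff ℝ ∞ φ) (h' : ContDiff ℝ ∞ ψ) (v : E) :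
    dd v (fun x => φ x + ψ x) = fun x => dd v φ x + dd v ψ x := by
  funext x
  unfold dd
  rw [fderiv_fun_add (differentiable_of_smooth h x) (differentiable_of_smooth h' x)]
  simp

lemma dd_neg (φ : E → ℝ) (v : E) : dd v (fun x => - φ x) = fun x => - dd v φ x := by
  funext x
  unfold dd
  rw [fderiv_fun_neg]
  simp

lemma dd_eq_zero_of_eqOn_open {φ : E → ℝ} {U : Set E} (hU : IsOpen U) {c : ℝ}
    (h : ∀ x ∈ U, φ x = c) (v : E) : ∀ x ∈ U, dd v φ x = 0 := by
  intro x hx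
  have : φ =ᶠ[𝓝 x] fun _ => c := by
    filter_upwards [hU.mem_nhds hx] with y hy using h y hy
  unfold dd
  rw [this.fderiv_eq]
  simp

lemma integral_mul_dd [MeasurableSpace E] [BorelSpace E] [FiniteDimensional ℝ E]
    (m : Measure E) [m.IsAddHaarMeasure] {φ ψ : E → ℝ}
    (h : IsTest φ) (h' : ContDiff ℝ ∞ ψ) (v : E) :
    ∫ x, φ x * dd v ψ x ∂m = - ∫ x, dd v φ x * ψ x ∂m :=
  integral_mul_fderiv_eq_neg_fderiv_mul_of_integrable
    (((h.dd v).mul h').integrable m) ((h.mul (contDiff_dd h' v)).integrable m)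
    ((h.mul h').integrable m) (fun x _ => differentiable_of_smooth h.1 x)
    (fun x _ => differentiable_of_smooth h' x)

/-- The average of translates of `g` with respect to the measure `m`. -/
noncomputable def av [MeasurableSpace E] (m : Measure E) (g : E → ℝ) : E → ℝ :=
  fun y => ∫ x, g (y - x) ∂m

section av

variable [MeasurableSpace E] [BorelSpace E] [FiniteDimensional ℝ E]
  (m : Measure E) [IsFiniteMeasure m]

lemma contDiff_av {g : E → ℝ} (hg : IsTest g) : ContDiff ℝ ∞ (av m g) := by
  have h : av m g = (fun _ => (1 : ℝ)) ⋆[ContinuousLinearMap.lsmul ℝ ℝ, m] g := by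
    funext y
    simp [av, convolution]
  rw [h]
  exact hg.2.contDiff_convolution_right _ (locallyIntegrable_const _) hg.1

lemma dd_av {g : E → ℝ} (hg : IsTest g) (v : E) : dd v (av m g) = av m (dd v g) := by
  funext y
  have hc : Continuous (fderiv ℝ g) := hg.1.continuous_fderiv (by simp)
  obtain ⟨C, hC⟩ := (hg.2.fderiv ℝ).exists_bound_of_continuous hc
  have hint : Integrable (fun t => fderiv ℝ g (y - t)) m :=
    Integrable.of_bound (by fun_prop) C (Eventually.of_forall fun t => hC _)
  obtain ⟨C', _, hC'⟩ := hg.exists_bound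
  have hgc := hg.continuous
  have h1 : HasFDerivAt (av m g) (∫ t, fderiv ℝ g (y - t) ∂m) y := by
    refine hasFDerivAt_integral_of_dominated_of_fderiv_le (s := univ) (bound := fun _ => C)
      (F := fun y x => g (y - x)) (F' := fun y x => fderiv ℝ g (y - x))
      univ_mem (Eventually.of_forall fun y => ?_) ?_ hint.aestronglyMeasurable
      (Eventually.of_forall fun t z _ => hC _) (integrable_const _)
      (Eventually.of_forall fun t z _ => ?_)
    · exact (hgc.comp (continuous_const.sub continuous_id)).aestronglyMeasurable
    · exact Integrable.of_bound
        (hgc.comp (continuous_const.sub continuous_id)).aestronglyMeasurable C'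
        (Eventually.of_forall fun t => hC' _)
    · simpa using! (differentiable_of_smooth hg.1 (z - t)).hasFDerivAt.comp z
        ((hasFDerivAt_id z).sub (hasFDerivAt_const t z))
  unfold dd
  rw [h1.fderiv, ContinuousLinearMap.integral_apply hint]
  rfl

lemma isTest_av {g : E → ℝ} (hg : IsTest g) {R : ℝ} (hm : m (closedBall 0 R)ᶜ = 0) :
    IsTest (av m g) := by
  refine ⟨contDiff_av m hg, ?_⟩
  refine HasCompactSupport.intro (hg.2.isCompact.add (isCompact_closedBall (0 : E) R)) ?_
  intro y hy
  have : ∀ᵐ x ∂m, g (y - x) = 0 := by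
    have hm' : ∀ᵐ x ∂m, x ∈ closedBall (0 : E) R := hm
    filter_upwards [hm'] with x hx
    by_contra hne
    exact hy ⟨y - x, subset_tsupport g hne, x, hx, by simp⟩
  simp only [av]
  rw [integral_congr_ae this]
  simp

end av

end Directional

/-- Euclidean space of dimension `d`. -/
abbrev Euc (d : ℕ) := EuclideanSpace ℝ (Fin d)

variable {d : ℕ}

/-- The standard basis vectors. -/
noncomputable abbrev ee (i : Fin d) : Euc d := EuclideanSpace.single i (1 : ℝ)

/-- The Laplacian. -/
noncomputable def lap (φ : Euc d → ℝ) : Euc d → ℝ := fun x => ∑ i : Fin d, dd (ee i) (dd (ee i) φ) x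

lemma IsTest.lap {φ : Euc d → ℝ} (h : IsTest φ) : IsTest (lap φ) :=
  IsTest.sum _ fun _ => (h.dd _).dd _

/-- A radial mollifier `η` together with a radial potential `ζ` satisfying `∇ζ(z) = -η(z) z`. -/
structure KernelPair (η ζ : Euc d → ℝ) : Prop where
  test_η : IsTest η
  test_ζ : IsTest ζ
  nonneg_η : ∀ z, 0 ≤ η z
  nonneg_ζ : ∀ z, 0 ≤ ζ z
  zero_η : ∀ z, 1 ≤ ‖z‖ → η z = 0
  zero_ζ : ∀ z, 1 ≤ ‖z‖ → ζ z = 0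
  integral_η : ∫ z, η z = 1
  dd_ζ : ∀ z v, dd v ζ z = - η z * inner ℝ z v

lemma exists_radial_profile : ∃ ψ Z : ℝ → ℝ, ContDiff ℝ ∞ ψ ∧ ContDiff ℝ ∞ Z ∧ (∀ t, 0 ≤ ψ t) ∧
    (∀ t, 0 ≤ Z t) ∧ (∀ t, 1 ≤ t → ψ t = 0) ∧ (∀ t, 1 ≤ t → Z t = 0) ∧ ψ 0 = 1 ∧
    ∀ t, HasDerivAt Z (- ψ t / 2) t := by
  let b : ContDiffBump (0 : ℝ) := ⟨1/4, 1/2, by norm_num, by norm_num⟩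
  have hb : ContDiff ℝ ∞ b := b.contDiff
  have hb0 : ∀ t : ℝ, 1 / 2 ≤ t → b t = 0 := fun t ht => b.zero_of_le_dist (by
    rw [Real.dist_eq, sub_zero]; exact ht.trans (le_abs_self t))
  have hd : ∀ t, HasDerivAt (fun t => (∫ u in t..1, b u) / 2) (- b t / 2) t := fun t =>
    (intervalIntegral.integral_hasDerivAt_left (hb.continuous.intervalIntegrable _ _)
      (hb.continuous.stronglyMeasurableAtFilter _ _) hb.continuous.continuousAt).div_const 2
  refine ⟨b, fun t => (∫ u in t..1, b u) / 2, hb, ?_, fun t => b.nonneg, ?_,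
    fun t ht => hb0 t (by linarith), ?_, ?_, hd⟩
  · rw [contDiff_infty_iff_deriv]
    refine ⟨fun t => (hd t).differentiableAt, ?_⟩
    rw [show deriv (fun t => (∫ u in t..1, b u) / 2) = fun t => - b t / 2 from
      funext fun t => (hd t).deriv]
    exact hb.neg.div_const 2
  · intro t
    rcases le_total t 1 with h | h
    · have := intervalIntegral.integral_nonneg (μ := volume) h (fun u _ => b.nonneg (x := u))
      positivity
    · dsimp only
      rw [intervalIntegral.integral_symm, intervalIntegral.integral_zero_ae]
      · simp
      · refine Eventually.of_forall fun u hu => hb0 u ?_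
        rw [uIoc_of_le h] at hu
        linarith [hu.1]
  · intro t h
    dsimp only
    rw [intervalIntegral.integral_symm, intervalIntegral.integral_zero_ae]
    · simp
    · refine Eventually.of_forall fun u hu => hb0 u ?_
      rw [uIoc_of_le h] at hu
      linarith [hu.1]
  · exact b.one_of_mem_closedBall (by simp [b])

lemma exists_kernelPair (d : ℕ) : ∃ η ζ : Euc d → ℝ, KernelPair η ζ := by
  obtain ⟨ψ, Z, hψ, hZ, hψ0, hZ0, hψ1, hZ1, hψ2, hd⟩ := exists_radial_profile
  have hsq : ContDiff ℝ ∞ (fun z : Euc d => ‖z‖ ^ 2) := contDiff_norm_sq ℝ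
  have htest : ∀ f : ℝ → ℝ, ContDiff ℝ ∞ f → (∀ t, 1 ≤ t → f t = 0) →
      IsTest (fun z : Euc d => f (‖z‖ ^ 2)) := by
    intro f hf hf1
    refine ⟨hf.comp hsq, HasCompactSupport.intro (isCompact_closedBall (0 : Euc d) 1) ?_⟩
    intro z hz
    have : 1 < ‖z‖ := by simpa using hz
    exact hf1 _ (by nlinarith)
  have hη := htest ψ hψ hψ1
  set c := ∫ z : Euc d, ψ (‖z‖ ^ 2) with hc
  have hcpos : 0 < c := by
    rw [hc]
    refine hη.continuous.integral_pos_of_hasCompactSupport_nonneg_nonzero hη.2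
      (fun z => hψ0 _) (x := 0) ?_
    simp [hψ2]
  have hconst : ∀ f : Euc d → ℝ, IsTest f → IsTest (fun z => f z / c) := by
    intro f hf
    simpa only [div_eq_mul_inv] using hf.mul (contDiff_const (c := c⁻¹))
  have hle : ∀ z : Euc d, 1 ≤ ‖z‖ → 1 ≤ ‖z‖ ^ 2 := fun z hz => by nlinarith
  refine ⟨fun z => ψ (‖z‖ ^ 2) / c, fun z => Z (‖z‖ ^ 2) / c, hconst _ hη,
    hconst _ (htest Z hZ hZ1), fun z => div_nonneg (hψ0 _) hcpos.le,
    fun z => div_nonneg (hZ0 _) hcpos.le, fun z hz => by simp [hψ1 _ (hle z hz)],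
    fun z hz => by simp [hZ1 _ (hle z hz)], ?_, ?_⟩
  · rw [integral_div, ← hc, div_self hcpos.ne']
  · intro z v
    have h1 : HasFDerivAt (fun z : Euc d => ‖z‖ ^ 2) (2 • innerSL ℝ z) z :=
      (hasStrictFDerivAt_norm_sq z).hasFDerivAt
    have h2 := ((hd (‖z‖ ^ 2)).comp_hasFDerivAt z h1).mul_const c⁻¹
    have h3 : (fun z : Euc d => Z (‖z‖ ^ 2) / c) = fun z => (Z ∘ fun z => ‖z‖ ^ 2) z * c⁻¹ := by
      funext z; simp [div_eq_mul_inv]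
    unfold dd
    rw [h3, h2.fderiv]
    simp
    ring

/-- Averages of translates at scale `s` against the weight `θ`. -/
noncomputable def sc (θ : Euc d → ℝ) (s : ℝ) (g : Euc d → ℝ) : Euc d → ℝ :=
  fun y => ∫ z, g (y - s • z) * θ z

section sc

variable {θ : Euc d → ℝ} {g : Euc d → ℝ}

lemma contDiff_shift (hg : ContDiff ℝ ∞ g) (s : ℝ) (y : Euc d) :
    ContDiff ℝ ∞ fun z : Euc d => g (y - s • z) :=
  hg.comp (by fun_prop)

lemma integrable_sc (hθ : IsTest θ) (hg : ContDiff ℝ ∞ g) (s : ℝ) (y : Euc d) :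
    Integrable fun z => g (y - s • z) * θ z :=
  (IsTest.mul' (contDiff_shift hg s y) hθ).integrable _

lemma dd_shift (hg : ContDiff ℝ ∞ g) (s : ℝ) (y v : Euc d) :
    dd v (fun z : Euc d => g (y - s • z)) = fun z => - s * dd v g (y - s • z) := by
  funext z
  have h1 : HasFDerivAt (fun z : Euc d => y - s • z) (-(s • ContinuousLinearMap.id ℝ (Euc d))) z :=
    ((hasFDerivAt_id z).const_smul s).const_sub y
  have h2 := (differentiable_of_smooth hg (y - s • z)).hasFDerivAt.comp z h1
  unfold dd
  rw [show (fun z : Euc d => g (y - s • z)) = g ∘ fun z => y - s • z from rfl, h2.fderiv]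
  simp

lemma isFiniteMeasure_withDensity_test (hθ : IsTest θ) :
    IsFiniteMeasure ((volume : Measure (Euc d)).withDensity fun z => ENNReal.ofReal (θ z)) :=
  isFiniteMeasure_withDensity_ofReal (hθ.integrable volume).2

lemma measurable_weight (hθ : IsTest θ) :
    Measurable fun z : Euc d => ENNReal.ofReal (θ z) :=
  ENNReal.measurable_ofReal.comp hθ.continuous.measurable

lemma integral_weight (hθ : IsTest θ) (h0 : ∀ z, 0 ≤ θ z) (F : Euc d → ℝ) :
    ∫ z, F z ∂((volume : Measure (Euc d)).withDensity fun z => ENNReal.ofReal (θ z)) =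
      ∫ z, F z * θ z := by
  rw [integral_withDensity_eq_integral_toReal_smul (measurable_weight hθ)
    (Eventually.of_forall fun _ => ENNReal.ofReal_lt_top)]
  refine integral_congr_ae (Eventually.of_forall fun z => ?_)
  simp [ENNReal.toReal_ofReal (h0 z), mul_comm]

lemma weight_compl_closedBall (hz : ∀ z, 1 ≤ ‖z‖ → θ z = 0) :
    (volume : Measure (Euc d)).withDensity (fun z => ENNReal.ofReal (θ z)) (closedBall 0 1)ᶜ
      = 0 := by
  rw [withDensity_apply _ measurableSet_closedBall.compl]
  rw [setLIntegral_congr_fun (g := fun _ => 0) measurableSet_closedBall.compl]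
  · simp
  · intro z hz'
    have : 1 < ‖z‖ := by simpa using hz'
    simp [hz z this.le]

lemma sc_eq_av (hθ : IsTest θ) (h0 : ∀ z, 0 ≤ θ z) (hg : Continuous g) (s : ℝ) :
    sc θ s g = av (((volume : Measure (Euc d)).withDensity
      fun z => ENNReal.ofReal (θ z)).map fun z => s • z) g := by
  funext y
  unfold av sc
  rw [integral_map (by fun_prop)
    (by fun_prop : Continuous fun x => g (y - x)).aestronglyMeasurable]
  rw [integral_weight hθ h0 (fun z => g (y - s • z))]

lemma sc_measure_compl (hz : ∀ z, 1 ≤ ‖z‖ → θ z = 0) (s : ℝ) :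
    ((volume : Measure (Euc d)).withDensity
      fun z => ENNReal.ofReal (θ z)).map (fun z => s • z) (closedBall 0 |s|)ᶜ = 0 := by
  rw [Measure.map_apply (by fun_prop) measurableSet_closedBall.compl]
  refine measure_mono_null ?_ (weight_compl_closedBall hz)
  intro z hz'
  simp only [mem_preimage, mem_compl_iff, mem_closedBall, dist_zero_right, norm_smul,
    Real.norm_eq_abs] at hz' ⊢
  contrapose! hz'
  nlinarith [abs_nonneg s]

lemma isTest_sc (hθ : IsTest θ) (h0 : ∀ z, 0 ≤ θ z) (hz : ∀ z, 1 ≤ ‖z‖ → θ z = 0)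
    (hg : IsTest g) (s : ℝ) : IsTest (sc θ s g) := by
  have := isFiniteMeasure_withDensity_test hθ
  rw [sc_eq_av hθ h0 hg.continuous]
  exact isTest_av _ hg (sc_measure_compl hz s)

lemma dd_sc (hθ : IsTest θ) (h0 : ∀ z, 0 ≤ θ z) (hg : IsTest g) (s : ℝ) (v : Euc d) :
    dd v (sc θ s g) = sc θ s (dd v g) := by
  have := isFiniteMeasure_withDensity_test hθ
  rw [sc_eq_av hθ h0 hg.continuous, sc_eq_av hθ h0 (hg.dd v).continuous, dd_av _ hg]

lemma smul_sc_dd (hθ : IsTest θ) (hg : ContDiff ℝ ∞ g) (s : ℝ) (v y : Euc d) :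
    s * sc θ s (dd v g) y = sc (dd v θ) s g y := by
  have h := integral_mul_dd volume hθ (contDiff_shift hg s y) v
  rw [dd_shift hg] at h
  unfold sc
  rw [← integral_const_mul]
  have e1 : (∫ z, s * (dd v g (y - s • z) * θ z)) = - ∫ z, θ z * (- s * dd v g (y - s • z)) := by
    rw [← integral_neg]; congr 1; funext z; ring
  rw [e1, h, neg_neg]
  congr 1; funext z; ring

lemma abs_sc_le (hθ : IsTest θ) {C : ℝ} (hC : ∀ x, |g x| ≤ C)
    (s : ℝ) (y : Euc d) : |sc θ s g y| ≤ C * ∫ z, |θ z| := by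
  have hi : Integrable fun z => |θ z| := (hθ.integrable volume).abs
  unfold sc
  rw [← integral_const_mul]
  refine norm_integral_le_of_norm_le (f := fun z => g (y - s • z) * θ z) (hi.const_mul C)
    (Eventually.of_forall fun z => ?_)
  rw [Real.norm_eq_abs, abs_mul]
  exact mul_le_mul_of_nonneg_right (hC _) (abs_nonneg _)

lemma integral_scale (F : Euc d → ℝ) {s : ℝ} (hs : 0 < s) (y : Euc d) :
    ∫ z, F (y - s • z) = (s ^ d)⁻¹ * ∫ x, F x := by
  rw [Measure.integral_comp_smul volume (fun z => F (y - z)) s,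
    integral_sub_left_eq_self F volume y]
  simp [abs_of_pos hs]

lemma abs_sc_le_scale {C : ℝ} (hC : ∀ x, |θ x| ≤ C)
    (hg : IsTest g) {s : ℝ} (hs : 0 < s) (y : Euc d) :
    |sc θ s g y| ≤ C * (s ^ d)⁻¹ * ∫ x, |g x| := by
  rw [mul_assoc, ← integral_scale (fun x => |g x|) hs y, ← integral_const_mul]
  unfold sc
  have hi : Integrable (fun z => |g (y - s • z)|) := by
    have h1 : Integrable (fun z => |g (y - z)|) := ((hg.integrable volume).comp_sub_left y).abs
    exact h1.comp_smul hs.ne'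
  refine norm_integral_le_of_norm_le (f := fun z => g (y - s • z) * θ z) (hi.const_mul C)
    (Eventually.of_forall fun z => ?_)
  rw [Real.norm_eq_abs, abs_mul, mul_comm]
  exact mul_le_mul_of_nonneg_right (hC _) (abs_nonneg _)

lemma continuous_sc_scale (hθ : IsTest θ) (hg : IsTest g) (y : Euc d) :
    Continuous fun s => sc θ s g y := by
  obtain ⟨C, _, hC⟩ := hg.exists_bound
  have hi : Integrable fun z => |θ z| := (hθ.integrable volume).abs
  refine continuous_of_dominated (bound := fun z => C * |θ z|)
    (fun s => (integrable_sc hθ hg.1 s y).aestronglyMeasurable)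
    (fun s => Eventually.of_forall fun z => ?_) (hi.const_mul C)
    (Eventually.of_forall fun z => ?_)
  · rw [Real.norm_eq_abs, abs_mul]
    exact mul_le_mul_of_nonneg_right (hC _) (abs_nonneg _)
  · exact (hg.continuous.comp (by fun_prop)).mul continuous_const

lemma sc_sum {ι : Type*} (t : Finset ι) (hθ : IsTest θ) {G : ι → Euc d → ℝ}
    (hG : ∀ i, IsTest (G i)) (s : ℝ) (y : Euc d) :
    sc θ s (fun x => ∑ i ∈ t, G i x) y = ∑ i ∈ t, sc θ s (G i) y := by
  unfold sc
  simp only [Finset.sum_mul]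
  exact integral_finsetSum _ fun i _ => integrable_sc hθ (hG i).1 s y

end sc

namespace KernelPair

variable {η ζ : Euc d → ℝ} {g : Euc d → ℝ}

lemma hasDerivAt_sc (K : KernelPair η ζ) (hg : IsTest g) (y : Euc d) (s : ℝ) :
    HasDerivAt (fun s => sc η s g y) (s * sc ζ s (lap g) y) s := by
  have hc : Continuous (fderiv ℝ g) := hg.1.continuous_fderiv (by simp)
  obtain ⟨C, hC⟩ := (hg.2.fderiv ℝ).exists_bound_of_continuous hc
  have key : s * sc ζ s (lap g) y = ∫ z, fderiv ℝ g (y - s • z) (-z) * η z := by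
    have h1 : ∀ i, s * sc ζ s (dd (ee i) (dd (ee i) g)) y = sc (dd (ee i) ζ) s (dd (ee i) g) y :=
      fun i => smul_sc_dd K.test_ζ (hg.dd _).1 s _ y
    have h2 : sc ζ s (lap g) y = ∑ i, sc ζ s (dd (ee i) (dd (ee i) g)) y :=
      sc_sum _ K.test_ζ (fun i => (hg.dd _).dd _) s y
    rw [h2, Finset.mul_sum, Finset.sum_congr rfl fun i _ => h1 i]
    unfold sc
    rw [← integral_finsetSum _ fun i _ => integrable_sc (K.test_ζ.dd _) (hg.dd _).1 s y]
    congr 1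
    funext z
    have hz : z = ∑ i, z i • ee i := by
      ext j
      simp [Pi.single_apply]
    have h4 : fderiv ℝ g (y - s • z) z = ∑ i, z i * dd (ee i) g (y - s • z) := by
      have h5 : ∀ L : Euc d →L[ℝ] ℝ, L z = ∑ i, z i * L (ee i) := by
        intro L
        conv_lhs => rw [hz]
        rw [map_sum]
        simp
      exact h5 _
    rw [map_neg, h4, ← Finset.sum_neg_distrib, Finset.sum_mul]
    refine Finset.sum_congr rfl fun i _ => ?_
    rw [K.dd_ζ]
    have : inner ℝ z (ee i) = z i := by simp [EuclideanSpace.inner_single_right]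
    rw [this]
    ring
  rw [key]
  refine (hasDerivAt_integral_of_dominated_loc_of_deriv_le (s := univ)
    (bound := fun z => C * |η z|) (F := fun s z => g (y - s • z) * η z)
    (F' := fun s z => fderiv ℝ g (y - s • z) (-z) * η z) univ_mem
    (Eventually.of_forall fun s => (integrable_sc K.test_η hg.1 s y).aestronglyMeasurable)
    (integrable_sc K.test_η hg.1 s y) ?_ (Eventually.of_forall fun z t _ => ?_)
    ((K.test_η.integrable volume).abs.const_mul C) (Eventually.of_forall fun z t _ => ?_)).2
  · refine Continuous.aestronglyMeasurable ?_
    exact ((hc.comp (by fun_prop : Continuous fun z : Euc d => y - s • z)).clm_apply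
      continuous_neg).mul K.test_η.continuous
  · rw [Real.norm_eq_abs, abs_mul]
    by_cases hz : 1 ≤ ‖z‖
    · simp [K.zero_η z hz]
    · refine mul_le_mul_of_nonneg_right ?_ (abs_nonneg _)
      rw [← Real.norm_eq_abs]
      refine ((fderiv ℝ g (y - t • z)).le_opNorm (-z)).trans ?_
      rw [norm_neg]
      push Not at hz
      have := hC (y - t • z)
      nlinarith [norm_nonneg (fderiv ℝ g (y - t • z)), norm_nonneg z]
  · have h1 : HasDerivAt (fun t : ℝ => y - t • z) (-z) t := by
      simpa using ((hasDerivAt_id t).smul_const z).const_sub y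
    exact ((differentiable_of_smooth hg.1 (y - t • z)).hasFDerivAt.comp_hasDerivAt t h1).mul_const _

lemma sc_sub_sc (K : KernelPair η ζ) (hg : IsTest g) (y : Euc d) (a b : ℝ) :
    sc η b g y - sc η a g y = ∫ s in a..b, s * sc ζ s (lap g) y :=
  (intervalIntegral.integral_eq_sub_of_hasDerivAt (fun s _ => K.hasDerivAt_sc hg y s)
    ((continuous_id.mul (continuous_sc_scale K.test_ζ hg.lap y)).intervalIntegrable _ _)).symm

lemma sc_zero (K : KernelPair η ζ) (y : Euc d) : sc η 0 g y = g y := by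
  simp [sc, integral_const_mul, K.integral_η]

end KernelPair

/-- A local potential of `g`: a compactly supported solution of `Δ W = g` up to a smooth error. -/
noncomputable def pot (ζ g : Euc d → ℝ) : Euc d → ℝ :=
  fun y => - ∫ s in (0:ℝ)..1, s * sc ζ s g y

/-- The measure whose averages represent `- pot`. -/
noncomputable def potMeasure (ζ : Euc d → ℝ) : Measure (Euc d) :=
  ((((volume : Measure ℝ).restrict (Ioc 0 1)).withDensity fun s => ENNReal.ofReal s).prod
    ((volume : Measure (Euc d)).withDensity fun z => ENNReal.ofReal (ζ z))).map
      fun p => p.1 • p.2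

namespace KernelPair

variable {η ζ g : Euc d → ℝ}

lemma isFiniteMeasure_radial :
    IsFiniteMeasure (((volume : Measure ℝ).restrict (Ioc 0 1)).withDensity
      fun s => ENNReal.ofReal s) :=
  isFiniteMeasure_withDensity_ofReal
    ((continuous_id.integrableOn_Icc (a := (0 : ℝ)) (b := 1)).mono_set Ioc_subset_Icc_self).2

lemma isFiniteMeasure_potMeasure (K : KernelPair η ζ) : IsFiniteMeasure (potMeasure ζ) := by
  have := isFiniteMeasure_radial
  have := isFiniteMeasure_withDensity_test K.test_ζ
  unfold potMeasure
  infer_instance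

lemma pot_eq_av (K : KernelPair η ζ) (hg : IsTest g) :
    pot ζ g = fun y => - av (potMeasure ζ) g y := by
  have := isFiniteMeasure_radial
  have := isFiniteMeasure_withDensity_test K.test_ζ
  obtain ⟨C, hC0, hC⟩ := hg.exists_bound
  funext y
  unfold av pot potMeasure
  have hc : Continuous fun p : ℝ × Euc d => g (y - p.1 • p.2) := hg.continuous.comp (by fun_prop)
  have hc' : Continuous fun x => g (y - x) := hg.continuous.comp (by fun_prop)
  rw [integral_map (by fun_prop)
    (hc' : Continuous fun x => g (y - x)).aestronglyMeasurable,
    integral_prod _ (Integrable.of_bound (C := C) hc.aestronglyMeasurable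
      (Eventually.of_forall fun p => hC _))]
  simp only [integral_weight K.test_ζ K.nonneg_ζ]
  rw [integral_withDensity_eq_integral_toReal_smul ENNReal.measurable_ofReal
    (Eventually.of_forall fun _ => ENNReal.ofReal_lt_top),
    intervalIntegral.integral_of_le zero_le_one]
  congr 1
  refine setIntegral_congr_fun measurableSet_Ioc fun s hs => ?_
  simp [ENNReal.toReal_ofReal hs.1.le, sc]

lemma potMeasure_compl (K : KernelPair η ζ) : potMeasure ζ (closedBall 0 1)ᶜ = 0 := by
  have := isFiniteMeasure_radial
  have := isFiniteMeasure_withDensity_test K.test_ζ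
  unfold potMeasure
  rw [Measure.map_apply (by fun_prop) measurableSet_closedBall.compl]
  refine measure_mono_null (t := ((Ioc (0:ℝ) 1)ᶜ ×ˢ univ) ∪ (univ ×ˢ (closedBall 0 1)ᶜ)) ?_ ?_
  · rintro ⟨s, z⟩ h
    by_contra hn
    simp only [mem_union, mem_prod, mem_univ, and_true, true_and, not_or, mem_compl_iff,
      not_not, mem_closedBall, dist_zero_right] at hn
    apply h
    simp only [mem_closedBall, dist_zero_right, norm_smul, Real.norm_eq_abs, abs_of_pos hn.1.1]
    nlinarith [hn.1.1, hn.1.2, norm_nonneg z]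
  · refine measure_union_null ?_ ?_
    · rw [Measure.prod_prod]
      have : (((volume : Measure ℝ).restrict (Ioc 0 1)).withDensity
        fun s => ENNReal.ofReal s) (Ioc 0 1)ᶜ = 0 :=
        withDensity_absolutelyContinuous _ _ (by
          rw [Measure.restrict_apply measurableSet_Ioc.compl]; simp)
      simp [this]
    · rw [Measure.prod_prod, weight_compl_closedBall K.zero_ζ, mul_zero]

lemma isTest_pot (K : KernelPair η ζ) (hg : IsTest g) : IsTest (pot ζ g) := by
  have := K.isFiniteMeasure_potMeasure
  rw [K.pot_eq_av hg]
  have h := isTest_av _ hg K.potMeasure_compl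
  exact ⟨h.1.neg, by simpa [HasCompactSupport, tsupport, Function.support] using h.2⟩

lemma dd_pot (K : KernelPair η ζ) (hg : IsTest g) (v : Euc d) :
    dd v (pot ζ g) = pot ζ (dd v g) := by
  have := K.isFiniteMeasure_potMeasure
  rw [K.pot_eq_av hg, K.pot_eq_av (hg.dd v), dd_neg, dd_av _ hg]

lemma intervalIntegrable_pot (K : KernelPair η ζ) (hg : IsTest g) (y : Euc d) (a b : ℝ) :
    IntervalIntegrable (fun s => s * sc ζ s g y) volume a b :=
  (continuous_id.mul (continuous_sc_scale K.test_ζ hg y)).intervalIntegrable _ _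

lemma lap_pot (K : KernelPair η ζ) (hg : IsTest g) (y : Euc d) :
    lap (pot ζ g) y = g y - sc η 1 g y := by
  have h := K.sc_sub_sc hg y 0 1
  rw [K.sc_zero] at h
  have h2 : lap (pot ζ g) y = - ∫ s in (0:ℝ)..1, s * sc ζ s (lap g) y := by
    unfold lap
    simp only [K.dd_pot hg, K.dd_pot (hg.dd _)]
    simp only [sc_sum Finset.univ K.test_ζ fun i => (hg.dd (ee i)).dd (ee i)]
    simp only [pot, Finset.mul_sum]
    rw [intervalIntegral.integral_finsetSum, Finset.sum_neg_distrib]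
    intro i _
    exact K.intervalIntegrable_pot ((hg.dd _).dd _) y 0 1
  linarith

end KernelPair

/-- An integral over `[0, 1]` of a function bounded by `A`, and by `B κ` beyond `κ`. -/
lemma abs_integral_le_of_split {F : ℝ → ℝ} (hF : Continuous F) {A B κ : ℝ} (hκ : 0 < κ)
    (hκ1 : κ ≤ 1) (hB : 0 ≤ B) (hA : ∀ s ∈ Ioc (0:ℝ) 1, |F s| ≤ A)
    (hFB : ∀ s ∈ Ioc κ 1, |F s| ≤ B * κ) : |∫ s in (0:ℝ)..1, F s| ≤ (A + B) * κ := by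
  rw [← intervalIntegral.integral_add_adjacent_intervals (hF.intervalIntegrable 0 κ)
    (hF.intervalIntegrable κ 1)]
  have h1 : |∫ s in (0:ℝ)..κ, F s| ≤ A * |κ - 0| :=
    intervalIntegral.norm_integral_le_of_norm_le_const (f := F) (C := A) fun s hs => by
      have hs' := uIoc_of_le hκ.le ▸ hs
      exact hA s ⟨hs'.1, hs'.2.trans hκ1⟩
  have h2 : |∫ s in κ..1, F s| ≤ B * κ * |1 - κ| :=
    intervalIntegral.norm_integral_le_of_norm_le_const (f := F) (C := B * κ) fun s hs =>
      hFB s (uIoc_of_le hκ1 ▸ hs)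
  rw [sub_zero, abs_of_pos hκ] at h1
  rw [abs_of_nonneg (sub_nonneg.2 hκ1)] at h2
  have h3 : B * κ * (1 - κ) ≤ B * κ := by nlinarith [mul_nonneg hB hκ.le]
  linarith [abs_add_le (∫ s in (0:ℝ)..κ, F s) (∫ s in κ..1, F s)]

lemma scaled_bound {Cθ κ m s : ℝ} (hC : 0 ≤ Cθ) (hκ : 0 < κ)
    (hm : m ≤ κ ^ (d + 1)) (hs : κ ≤ s) :
    Cθ * (s ^ d)⁻¹ * m ≤ Cθ * κ := by
  have hs0 : 0 < s := hκ.trans_le hs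
  have : (s ^ d)⁻¹ * m ≤ κ := by
    rw [inv_mul_le_iff₀ (by positivity)]
    calc m ≤ κ ^ (d + 1) := hm
      _ = κ ^ d * κ := pow_succ _ _
      _ ≤ s ^ d * κ := by gcongr
  rw [mul_assoc]
  gcongr

namespace KernelPair

variable {η ζ : Euc d → ℝ}

lemma exists_pot_bound (K : KernelPair η ζ) :
    ∃ C, 0 ≤ C ∧ ∀ (g : Euc d → ℝ) (κ : ℝ), IsTest g → (∀ x, 0 ≤ g x) →
    (∀ x, g x ≤ 1) → 0 < κ → κ ≤ 1 → ∫ x, g x ≤ κ ^ (d + 1) → ∀ y, |pot ζ g y| ≤ C * κ := by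
  obtain ⟨B, hB0, hB⟩ := K.test_ζ.exists_bound
  refine ⟨(∫ z, |ζ z|) + B, by positivity, fun g κ hg h0 h1 hκ hκ1 hm y => ?_⟩
  unfold pot
  rw [abs_neg]
  have hm' : ∫ x, |g x| ≤ κ ^ (d + 1) := by simpa only [abs_of_nonneg (h0 _)] using hm
  refine abs_integral_le_of_split (F := fun s => s * sc ζ s g y)
    (continuous_id.mul (continuous_sc_scale K.test_ζ hg y)) hκ hκ1
    hB0 (fun s hs => ?_) (fun s hs => ?_)
  · have := abs_sc_le K.test_ζ (C := 1) (fun x => by rw [abs_of_nonneg (h0 x)]; exact h1 x) s y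
    rw [abs_mul, abs_of_pos hs.1]
    nlinarith [hs.1, hs.2, abs_nonneg (sc ζ s g y)]
  · have hs0 := hκ.trans hs.1
    have := abs_sc_le_scale hB hg hs0 y
    have h3 := scaled_bound (d := d) hB0 hκ hm' hs.1.le
    rw [abs_mul, abs_of_pos hs0]
    nlinarith [hs.2, abs_nonneg (sc ζ s g y)]

lemma exists_dd_pot_bound (K : KernelPair η ζ) (v : Euc d) :

    ∃ C, 0 ≤ C ∧ ∀ (g : Euc d → ℝ) (κ : ℝ), IsTest g → (∀ x, 0 ≤ g x) →
    (∀ x, g x ≤ 1) → 0 < κ → κ ≤ 1 → ∫ x, g x ≤ κ ^ (d + 1) →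
      ∀ y, |dd v (pot ζ g) y| ≤ C * κ := by
  obtain ⟨B, hB0, hB⟩ := (K.test_ζ.dd v).exists_bound
  refine ⟨(∫ z, |dd v ζ z|) + B, by positivity, fun g κ hg h0 h1 hκ hκ1 hm y => ?_⟩
  rw [K.dd_pot hg]
  unfold pot
  rw [abs_neg]
  simp only [smul_sc_dd K.test_ζ hg.1]
  have hm' : ∫ x, |g x| ≤ κ ^ (d + 1) := by simpa only [abs_of_nonneg (h0 _)] using hm
  refine abs_integral_le_of_split (continuous_sc_scale (K.test_ζ.dd v) hg y) hκ hκ1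
    hB0 (fun s hs => ?_) (fun s hs => ?_)
  · have := abs_sc_le (K.test_ζ.dd v) (C := 1)
      (fun x => by rw [abs_of_nonneg (h0 x)]; exact h1 x) s y
    linarith
  · have hs0 := hκ.trans hs.1
    exact (abs_sc_le_scale hB hg hs0 y).trans
      (scaled_bound (d := d) hB0 hκ hm' hs.1.le)

lemma abs_sc_one_le (K : KernelPair η ζ) {g : Euc d → ℝ} (h0 : ∀ x, 0 ≤ g x) (h1 : ∀ x, g x ≤ 1)
    (s : ℝ) (y : Euc d) : 0 ≤ sc η s g y ∧ sc η s g y ≤ 1 := by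
  refine ⟨integral_nonneg fun z => mul_nonneg (h0 _) (K.nonneg_η _), ?_⟩
  rw [← K.integral_η]
  refine integral_mono_of_nonneg (Eventually.of_forall fun z => mul_nonneg (h0 _) (K.nonneg_η _))
    (K.test_η.integrable _) (Eventually.of_forall fun z => ?_)
  exact mul_le_of_le_one_left (K.nonneg_η _) (h1 _)

lemma integral_sc (K : KernelPair η ζ) {g : Euc d → ℝ} (hg : IsTest g) (s : ℝ) :
    ∫ y, sc η s g y = ∫ x, g x := by
  unfold sc
  have hi : Integrable (fun p : Euc d × Euc d => g (p.1 - s • p.2) * η p.2)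
      (volume.prod volume) := by
    rw [integrable_prod_iff' (by
      have := hg.continuous
      have := K.test_η.continuous
      exact (by fun_prop : Continuous fun p : Euc d × Euc d =>
        g (p.1 - s • p.2) * η p.2).aestronglyMeasurable)]
    refine ⟨Eventually.of_forall fun z =>
      (((hg.integrable volume).comp_sub_right (s • z)).mul_const (η z)), ?_⟩
    have : (fun z : Euc d => ∫ x, ‖g (x - s • z) * η z‖) = fun z => (∫ x, |g x|) * |η z| := by
      funext z
      simp only [norm_mul, Real.norm_eq_abs]
      rw [integral_mul_const, integral_sub_right_eq_self (fun x => |g x|)]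
    simp only at this ⊢
    rw [this]
    exact (K.test_η.integrable _).abs.const_mul _
  rw [integral_integral_swap hi]
  simp only [integral_mul_const, integral_sub_right_eq_self g]
  rw [integral_const_mul, K.integral_η, mul_one]

end KernelPair

lemma integral_dd_dd_sq {W : Euc d → ℝ} (hW : IsTest W) (a b : Euc d) :
    ∫ x, dd a (dd b W) x * dd a (dd b W) x = ∫ x, dd a (dd a W) x * dd b (dd b W) x := by
  have hb := hW.dd b
  rw [integral_mul_dd volume (hb.dd a) hb.1 a]
  have e : dd a (dd a (dd b W)) = dd b (dd a (dd a W)) := by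
    rw [dd_comm hW.1 a b, dd_comm (hW.dd a).1 a b]
  rw [e, ← integral_neg]
  have := integral_mul_dd volume ((hW.dd a).dd a) hb.1 b
  rw [this, integral_neg]

lemma integral_dd_sq_le_lap_sq {W : Euc d → ℝ} (hW : IsTest W) (i j : Fin d) :
    ∫ x, (dd (ee i) (dd (ee j) W) x) ^ 2 ≤ ∫ x, (lap W x) ^ 2 := by
  have key : ∑ i : Fin d, ∑ j : Fin d, ∫ x, (dd (ee i) (dd (ee j) W) x) ^ 2 =
      ∫ x, (lap W x) ^ 2 := by
    simp only [sq, integral_dd_dd_sq hW, lap, Finset.sum_mul_sum]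
    have hi : ∀ i j : Fin d, Integrable
        (fun x => dd (ee i) (dd (ee i) W) x * dd (ee j) (dd (ee j) W) x) := fun i j =>
      (((hW.dd _).dd _).mul ((hW.dd _).dd _).1).integrable _
    rw [integral_finsetSum _ fun i _ => integrable_finsetSum _ fun j _ => hi i j]
    simp only [integral_finsetSum _ fun j _ => hi _ j]
  rw [← key]
  have h0 : ∀ i j : Fin d, 0 ≤ ∫ x, (dd (ee i) (dd (ee j) W) x) ^ 2 := fun i j =>
    integral_nonneg fun x => sq_nonneg _
  calc _ ≤ ∑ j : Fin d, ∫ x, (dd (ee i) (dd (ee j) W) x) ^ 2 :=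
        Finset.single_le_sum (f := fun j => ∫ x, (dd (ee i) (dd (ee j) W) x) ^ 2)
          (fun j _ => h0 i j) (Finset.mem_univ j)
    _ ≤ _ := Finset.single_le_sum
          (f := fun i => ∑ j : Fin d, ∫ x, (dd (ee i) (dd (ee j) W) x) ^ 2)
          (fun i _ => Finset.sum_nonneg fun j _ => h0 i j) (Finset.mem_univ i)

lemma KernelPair.integral_dd_pot_sq_le {η ζ : Euc d → ℝ} (K : KernelPair η ζ) {g : Euc d → ℝ}
    (hg : IsTest g) (h0 : ∀ x, 0 ≤ g x) (h1 : ∀ x, g x ≤ 1) (i j : Fin d) :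
    ∫ x, (dd (ee i) (dd (ee j) (pot ζ g)) x) ^ 2 ≤ 2 * ∫ x, g x := by
  have hsc : IsTest (sc η 1 g) := isTest_sc K.test_η K.nonneg_η K.zero_η hg 1
  refine (integral_dd_sq_le_lap_sq (K.isTest_pot hg) i j).trans ?_
  simp only [K.lap_pot hg]
  calc ∫ x, (g x - sc η 1 g x) ^ 2 ≤ ∫ x, (g x + sc η 1 g x) := by
        refine integral_mono_of_nonneg (Eventually.of_forall fun x => sq_nonneg _)
          ((hg.add hsc).integrable _) (Eventually.of_forall fun x => ?_)
        have := K.abs_sc_one_le h0 h1 1 x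
        have := h0 x
        have := h1 x
        simp only
        nlinarith
    _ = 2 * ∫ x, g x := by
        rw [integral_add (hg.integrable _) (hsc.integrable _), K.integral_sc hg]
        ring

/-- The points where some ball of radius at least `δ` has `ρ`-density exceeding `t`. -/
def thick (ρ : Measure (Euc d)) (t δ : ℝ) : Set (Euc d) :=
  {z | ∃ s, δ ≤ s ∧ t * s ^ d < ρ.real (closedBall z s)}

section Thick

variable {ρ : Measure (Euc d)} [IsFiniteMeasure ρ] {t δ : ℝ}

lemma radius_le_of_thick (hd : 0 < d) (ht : 0 < t) {z : Euc d} {s : ℝ}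
    (h : t * s ^ d < ρ.real (closedBall z s)) : s ≤ 1 + ρ.real univ / t := by
  rcases le_total s 1 with h1 | h1
  · have : 0 ≤ ρ.real univ / t := by positivity
    linarith
  · have h2 : t * s ^ d < ρ.real univ := h.trans_le (measureReal_mono (subset_univ _))
    have h3 : s ≤ s ^ d := le_self_pow₀ h1 hd.ne'
    have h4 : s ^ d ≤ ρ.real univ / t := by
      rw [le_div_iff₀ ht]
      linarith
    linarith

lemma isBounded_thick (hd : 0 < d) (hρ : ρ (closedBall 0 2)ᶜ = 0) (ht : 0 < t) (hδ : 0 < δ) :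
    Bornology.IsBounded (thick ρ t δ) := by
  refine (isBounded_closedBall (x := (0 : Euc d)) (r := 2 + (1 + ρ.real univ / t))).subset ?_
  rintro z ⟨s, hs, h⟩
  have hr := radius_le_of_thick hd ht h
  rw [mem_closedBall]
  by_contra hn
  push Not at hn
  have : closedBall z s ⊆ (closedBall 0 2)ᶜ := by
    intro w hw hw'
    rw [mem_closedBall] at hw hw'
    have := dist_triangle z w 0
    rw [dist_comm] at hw
    linarith
  have h0 : ρ.real (closedBall z s) = 0 := by
    simp [Measure.real, measure_mono_null this hρ]
  rw [h0] at h
  have : 0 ≤ t * s ^ d := mul_nonneg ht.le (pow_nonneg (hδ.le.trans hs) _)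
  linarith

lemma volume_thickening_thick_le (hd : 0 < d) (ht : 0 < t) (hδ : 0 < δ) :
    volume (thickening (4 * δ) (thick ρ t δ)) ≤
      ENNReal.ofReal ((volume.real (ball (0 : Euc d) 1) * 9 ^ d) * ρ.real univ / t) := by
  classical
  have hch : ∀ z : Euc d, ∃ s, z ∈ thick ρ t δ → δ ≤ s ∧ t * s ^ d < ρ.real (closedBall z s) := by
    intro z
    by_cases hz : z ∈ thick ρ t δ
    · obtain ⟨s, hs⟩ := hz
      exact ⟨s, fun _ => hs⟩
    · exact ⟨0, fun h => absurd h hz⟩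
  choose r hr using hch
  obtain ⟨u, hut, hdisj, hcov⟩ := Vitali.exists_disjoint_subfamily_covering_enlargement_closedBall
    (thick ρ t δ) id r (1 + ρ.real univ / t)
    (fun a ha => radius_le_of_thick hd ht (hr a ha).2) 5 (by norm_num)
  simp only [id] at hdisj hcov
  have hrpos : ∀ b ∈ u, 0 < r b := fun b hb => hδ.trans_le (hr b (hut hb)).1
  have hcount : u.Countable := by
    refine hdisj.countable_of_nonempty_interior fun b hb => ?_
    rw [interior_closedBall _ (hrpos b hb).ne']
    exact nonempty_ball.2 (hrpos b hb)
  have hsub : thickening (4 * δ) (thick ρ t δ) ⊆ ⋃ b ∈ u, closedBall b (9 * r b) := by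
    intro z hz
    obtain ⟨a, ha, hza⟩ := mem_thickening_iff.1 hz
    obtain ⟨b, hb, hab⟩ := hcov a ha
    have h1 : a ∈ closedBall b (5 * r b) :=
      hab (mem_closedBall_self (hδ.le.trans (hr a ha).1))
    rw [mem_closedBall] at h1
    have h2 := (hr b (hut hb)).1
    refine mem_iUnion₂.2 ⟨b, hb, ?_⟩
    rw [mem_closedBall]
    linarith [dist_triangle z a b]
  have hball : ∀ b ∈ u, volume (closedBall b (9 * r b)) ≤
      ENNReal.ofReal ((volume.real (ball (0 : Euc d) 1) * 9 ^ d) / t) * ρ (closedBall b (r b)) := by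
    intro b hb
    have h0 := hrpos b hb
    rw [Measure.addHaar_closedBall _ _ (by positivity)]
    simp only [finrank_euclideanSpace, Fintype.card_fin]
    rw [← ofReal_measureReal (μ := volume) (s := ball (0 : Euc d) 1),
      ← ofReal_measureReal (μ := ρ) (s := closedBall b (r b)),
      ← ENNReal.ofReal_mul (by positivity), ← ENNReal.ofReal_mul (by positivity)]
    refine ENNReal.ofReal_le_ofReal ?_
    have h2 := (hr b (hut hb)).2
    rw [div_mul_eq_mul_div, le_div_iff₀ ht, mul_pow]
    have hc : 0 ≤ volume.real (ball (0 : Euc d) 1) * 9 ^ d := by positivity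
    nlinarith [mul_le_mul_of_nonneg_left h2.le hc]
  calc volume (thickening (4 * δ) (thick ρ t δ))
      ≤ volume (⋃ b ∈ u, closedBall b (9 * r b)) := measure_mono hsub
    _ ≤ ∑' b : u, volume (closedBall (b : Euc d) (9 * r b)) := measure_biUnion_le _ hcount _
    _ ≤ ∑' b : u, ENNReal.ofReal ((volume.real (ball (0 : Euc d) 1) * 9 ^ d) / t) *
          ρ (closedBall (b : Euc d) (r b)) := ENNReal.tsum_le_tsum fun b => hball b b.2
    _ = ENNReal.ofReal ((volume.real (ball (0 : Euc d) 1) * 9 ^ d) / t) *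
          ρ (⋃ b ∈ u, closedBall b (r b)) := by
        rw [ENNReal.tsum_mul_left, measure_biUnion hcount hdisj
          fun b _ => measurableSet_closedBall]
    _ ≤ ENNReal.ofReal ((volume.real (ball (0 : Euc d) 1) * 9 ^ d) / t) * ρ univ := by
        gcongr
        exact subset_univ _
    _ = _ := by
        rw [← ofReal_measureReal (μ := ρ) (s := univ), ← ENNReal.ofReal_mul (by positivity)]
        congr 1
        ring

lemma exists_cutoff (hd : 0 < d) : ∃ C : ℝ, 0 < C ∧ ∀ (ρ : Measure (Euc d)) [IsFiniteMeasure ρ],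
    ρ (closedBall 0 2)ᶜ = 0 → ∀ t δ : ℝ, 0 < t → 0 < δ → ∃ g : Euc d → ℝ, IsTest g ∧
      (∀ x, 0 ≤ g x) ∧ (∀ x, g x ≤ 1) ∧ (∀ x ∈ thickening (2 * δ) (thick ρ t δ), g x = 1) ∧
      ∫ x, g x ≤ C * ρ.real univ / t ∧
      volume (thickening (2 * δ) (thick ρ t δ)) ≤ ENNReal.ofReal (C * ρ.real univ / t) := by
  refine ⟨volume.real (ball (0 : Euc d) 1) * 9 ^ d, ?_, ?_⟩
  · have : 0 < volume.real (ball (0 : Euc d) 1) :=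
      ENNReal.toReal_pos (measure_ball_pos _ _ one_pos).ne' measure_ball_lt_top.ne
    positivity
  intro ρ _ hρ t δ ht hδ
  have hvol := volume_thickening_thick_le (ρ := ρ) hd ht hδ
  have hsub : cthickening (2 * δ) (thick ρ t δ) ⊆ thickening (4 * δ) (thick ρ t δ) :=
    cthickening_subset_thickening' (by positivity) (by linarith) _
  obtain ⟨f, hf0, hf1, hf⟩ := exists_contMDiffMap_zero_one_of_isClosed (n := ⊤)
    (modelWithCornersSelf ℝ (Euc d)) (s := (thickening (4 * δ) (thick ρ t δ))ᶜ)
    (t := cthickening (2 * δ) (thick ρ t δ)) isOpen_thickening.isClosed_compl isClosed_cthickening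
    (disjoint_left.2 fun x hx hx' => hx (hsub hx'))
  have hbd : Bornology.IsBounded (cthickening (4 * δ) (thick ρ t δ)) :=
    (isBounded_thick hd hρ ht hδ).cthickening
  have hsupp : ∀ x, x ∉ thickening (4 * δ) (thick ρ t δ) → f x = 0 := fun x hx => hf0 hx
  have htest : IsTest (f : Euc d → ℝ) := by
    refine ⟨f.contMDiff.contDiff, HasCompactSupport.intro
      (Metric.isCompact_of_isClosed_isBounded isClosed_cthickening hbd) fun x hx => ?_⟩
    exact hsupp x fun h => hx (thickening_subset_cthickening _ _ h)
  refine ⟨f, htest, fun x => (hf x).1, fun x => (hf x).2,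
    fun x hx => hf1 (thickening_subset_cthickening _ _ hx), ?_,
    (measure_mono ((thickening_subset_cthickening _ _).trans hsub)).trans hvol⟩
  have hfin : volume (thickening (4 * δ) (thick ρ t δ)) ≠ ⊤ := ne_top_of_le_ne_top (by simp) hvol
  calc ∫ x, f x ≤ ∫ x, (thickening (4 * δ) (thick ρ t δ)).indicator (fun _ => (1 : ℝ)) x := by
        refine integral_mono (htest.integrable _)
          ((integrable_indicator_iff isOpen_thickening.measurableSet).2
            (integrableOn_const hfin)) fun x => ?_
        by_cases hx : x ∈ thickening (4 * δ) (thick ρ t δ)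
        · simpa [hx] using (hf x).2
        · simp [hx, hsupp x hx]
    _ = volume.real (thickening (4 * δ) (thick ρ t δ)) := by
        rw [integral_indicator_const _ isOpen_thickening.measurableSet]
        simp
    _ ≤ _ := ENNReal.toReal_le_of_le_ofReal (by positivity) hvol

end Thick

lemma lintegral_sc_variable_le {η G s : Euc d → ℝ} (hη0 : ∀ z, 0 ≤ η z)
    (hη : IsTest η) (hη1 : ∀ z, 1 ≤ ‖z‖ → η z = 0) {C : ℝ} (hC : ∀ z, η z ≤ C) (hC0 : 0 ≤ C)
    (hG : IsTest G) (hG0 : ∀ x, 0 ≤ G x) (hs : ∀ x, 0 < s x)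
    (hlip : ∀ x y, |s x - s y| ≤ dist x y / 4) {A : ℝ} {ρ : Measure (Euc d)} [IsFiniteMeasure ρ]
    (hρ : ∀ x, ρ.real (closedBall x (2 * s x)) ≤ A * s x ^ d) :
    ∫⁻ y, ENNReal.ofReal (sc η (s y) G y) ∂ρ ≤
      ENNReal.ofReal (C * (5 / 4) ^ d * A) * ∫⁻ x, ENNReal.ofReal (G x) := by
  have hsc : Continuous s := by
    refine continuous_iff_continuousAt.2 fun x => ?_
    refine tendsto_iff_dist_tendsto_zero.2 ?_
    have h0 : Tendsto (fun y => dist y x / 4) (𝓝 x) (𝓝 0) := by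
      have : Continuous fun y : Euc d => dist y x / 4 := by fun_prop
      simpa using this.tendsto x
    exact squeeze_zero (fun _ => dist_nonneg) (fun y => by rw [Real.dist_eq]; exact hlip y x) h0
  have hpt : ∀ y, ENNReal.ofReal (sc η (s y) G y) ≤ ∫⁻ x, ENNReal.ofReal (G x) *
      (if dist x y ≤ s y then ENNReal.ofReal (C * (s y ^ d)⁻¹) else 0) := by
    intro y
    have e : sc η (s y) G y = (s y ^ d)⁻¹ * ∫ x, G x * η ((s y)⁻¹ • (y - x)) := by
      rw [← integral_scale _ (hs y) y]
      unfold sc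
      congr 1
      funext z
      rw [sub_sub_cancel, inv_smul_smul₀ (hs y).ne']
    have hc : ContDiff ℝ ∞ fun x : Euc d => η ((s y)⁻¹ • (y - x)) := hη.1.comp (by fun_prop)
    have hint : Integrable fun x => (s y ^ d)⁻¹ * (G x * η ((s y)⁻¹ • (y - x))) :=
      ((hG.mul hc).integrable volume).const_mul _
    have hp : 0 < s y ^ d := pow_pos (hs y) d
    rw [e, ← integral_const_mul, ofReal_integral_eq_lintegral_ofReal hint
      (Eventually.of_forall fun x => mul_nonneg (by positivity) (mul_nonneg (hG0 x) (hη0 _)))]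
    refine lintegral_mono fun x => ?_
    simp only
    split_ifs with h
    · rw [← ENNReal.ofReal_mul (hG0 x)]
      refine ENNReal.ofReal_le_ofReal ?_
      have h1 := mul_le_mul_of_nonneg_left (hC ((s y)⁻¹ • (y - x)))
        (mul_nonneg (inv_nonneg.2 hp.le) (hG0 x))
      nlinarith
    · rw [hη1]
      · simp
      · push Not at h
        rw [norm_smul, norm_inv, Real.norm_eq_abs, abs_of_pos (hs y), ← dist_eq_norm, dist_comm,
          le_inv_mul_iff₀ (hs y)]
        linarith
  have hmeas : Measurable (Function.uncurry fun y x : Euc d => ENNReal.ofReal (G x) *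
      (if dist x y ≤ s y then ENNReal.ofReal (C * (s y ^ d)⁻¹) else 0)) := by
    have hGm := hG.continuous.measurable
    have hsm := hsc.measurable
    refine Measurable.mul (by fun_prop) (Measurable.ite ?_ (by fun_prop) measurable_const)
    exact (isClosed_le (by fun_prop) (by fun_prop)).measurableSet
  calc ∫⁻ y, ENNReal.ofReal (sc η (s y) G y) ∂ρ
      ≤ ∫⁻ y, (∫⁻ x, ENNReal.ofReal (G x) *
      (if dist x y ≤ s y then ENNReal.ofReal (C * (s y ^ d)⁻¹) else 0)) ∂ρ := lintegral_mono hpt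
    _ = ∫⁻ x, ∫⁻ y, ENNReal.ofReal (G x) *
      (if dist x y ≤ s y then ENNReal.ofReal (C * (s y ^ d)⁻¹) else 0) ∂ρ :=
        lintegral_lintegral_swap hmeas.aemeasurable
    _ ≤ ∫⁻ x, ENNReal.ofReal (C * (5 / 4) ^ d * A) * ENNReal.ofReal (G x) := by
        refine lintegral_mono fun x => ?_
        rw [lintegral_const_mul' _ _ ENNReal.ofReal_ne_top, mul_comm]
        gcongr
        have hx : 0 < s x ^ d := pow_pos (hs x) d
        calc ∫⁻ y, (if dist x y ≤ s y then ENNReal.ofReal (C * (s y ^ d)⁻¹) else 0) ∂ρ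
            ≤ ∫⁻ y, (closedBall x (2 * s x)).indicator
                (fun _ => ENNReal.ofReal (C * ((5 / 4) ^ d * (s x ^ d)⁻¹))) y ∂ρ := by
              refine lintegral_mono fun y => ?_
              simp only
              split_ifs with h
              · have h1 := abs_le.1 (hlip x y)
                rw [indicator_of_mem]
                · refine ENNReal.ofReal_le_ofReal (mul_le_mul_of_nonneg_left ?_ hC0)
                  rw [← inv_le_inv₀ (by positivity) (by have := hs y; positivity), inv_inv,
                    mul_inv, inv_inv, ← inv_pow, ← mul_pow]
                  exact pow_le_pow_left₀ (by have := hs x; positivity) (by linarith) d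
                · rw [mem_closedBall, dist_comm]
                  linarith
              · exact zero_le
          _ = ENNReal.ofReal (C * ((5 / 4) ^ d * (s x ^ d)⁻¹)) * ρ (closedBall x (2 * s x)) := by
              rw [lintegral_indicator measurableSet_closedBall, setLIntegral_const]
          _ ≤ _ := by
              rw [← ofReal_measureReal, ← ENNReal.ofReal_mul (by positivity)]
              refine ENNReal.ofReal_le_ofReal ?_
              have := mul_le_mul_of_nonneg_left (hρ x)
                (show 0 ≤ C * ((5 / 4) ^ d * (s x ^ d)⁻¹) by positivity)
              refine this.trans (le_of_eq ?_)
              field_simp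
    _ = _ := lintegral_const_mul' _ _ ENNReal.ofReal_ne_top

namespace KernelPair

variable {η ζ : Euc d → ℝ}

lemma sq_sc_le (K : KernelPair η ζ) {h : Euc d → ℝ} (hh : IsTest h) (s : ℝ) (y : Euc d) :
    (sc η s h y) ^ 2 ≤ sc η s (fun x => h x ^ 2) y := by
  set c := sc η s h y with hc
  have h2 : IsTest fun x => h x ^ 2 := by simpa only [sq] using hh.mul hh.1
  have i1 := integrable_sc K.test_η hh.1 s y
  have i2 := integrable_sc K.test_η h2.1 s y
  have i3 := K.test_η.integrable volume
  have i4 : Integrable fun z => h (y - s • z) ^ 2 * η z - (2 * c) * (h (y - s • z) * η z) :=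
    i2.sub (i1.const_mul _)
  have e : ∫ z, (h (y - s • z) - c) ^ 2 * η z = sc η s (fun x => h x ^ 2) y - c ^ 2 := by
    calc ∫ z, (h (y - s • z) - c) ^ 2 * η z
        = ∫ z, (h (y - s • z) ^ 2 * η z - (2 * c) * (h (y - s • z) * η z) + c ^ 2 * η z) := by
          congr 1
          funext z
          ring
      _ = sc η s (fun x => h x ^ 2) y - (2 * c) * c + c ^ 2 * 1 := by
          rw [integral_add i4 (i3.const_mul _), integral_sub i2 (i1.const_mul _), integral_const_mul,
            integral_const_mul,
            K.integral_η]
          rfl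
      _ = _ := by ring
  have h0 : 0 ≤ ∫ z, (h (y - s • z) - c) ^ 2 * η z :=
    integral_nonneg fun z => mul_nonneg (sq_nonneg _) (K.nonneg_η z)
  linarith

/-- The Laplacian of a second derivative of the potential, where `g` is locally constant. -/
lemma exists_lap_dd_pot_bound (K : KernelPair η ζ) (a b : Euc d) :
    ∃ C, 0 ≤ C ∧ ∀ g : Euc d → ℝ, IsTest g →
    (∀ x, 0 ≤ g x) → ∀ U : Set (Euc d), IsOpen U → (∀ x ∈ U, g x = 1) →
    ∀ x ∈ U, |lap (dd a (dd b (pot ζ g))) x| ≤ C * ∫ x, g x := by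
  obtain ⟨C, hC0, hC⟩ := ((K.test_η.dd a).dd b).exists_bound
  refine ⟨C, hC0, fun g hg hg0 U hU hgU x hx => ?_⟩
  have h1 : lap (dd a (dd b (pot ζ g))) x =
      dd a (dd b g) x - sc η 1 (dd a (dd b g)) x := by
    rw [K.dd_pot hg, K.dd_pot (hg.dd b), K.lap_pot ((hg.dd b).dd a)]
  have h2 : dd a (dd b g) x = 0 :=
    dd_eq_zero_of_eqOn_open hU (dd_eq_zero_of_eqOn_open hU hgU b) a x hx
  have h3 : sc η 1 (dd a (dd b g)) x = sc (dd b (dd a η)) 1 g x := by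
    have e1 := smul_sc_dd K.test_η (hg.dd b).1 1 a x
    have e2 := smul_sc_dd (K.test_η.dd a) hg.1 1 b x
    linarith
  have h4 := abs_sc_le_scale hC hg one_pos x
  rw [h1, h2, h3, zero_sub, abs_neg]
  simpa only [one_pow, inv_one, mul_one, abs_of_nonneg (hg0 _)] using h4

lemma exists_sc_dd_pot_bound (K : KernelPair η ζ) (a b : Euc d) :
    ∃ C, 0 ≤ C ∧ ∀ g : Euc d → ℝ, IsTest g →
    (∀ x, 0 ≤ g x) → ∀ (y : Euc d) (δ s : ℝ), 0 < δ → δ ≤ s → s ≤ 1 →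
    (∀ x ∈ ball y (4 * s), g x = 1) →
    |sc η δ (dd a (dd b (pot ζ g))) y| ≤
      |sc η s (dd a (dd b (pot ζ g))) y| + C * ∫ x, g x := by
  obtain ⟨C, hC0, hC⟩ := K.exists_lap_dd_pot_bound a b
  have hI : 0 ≤ ∫ z, |ζ z| := by positivity
  refine ⟨C * ∫ z, |ζ z|, by positivity, fun g hg hg0 y δ s hδ hδs hs1 hgs => ?_⟩
  have hm0 : 0 ≤ ∫ x, g x := integral_nonneg hg0
  have hh : IsTest (dd a (dd b (pot ζ g))) := ((K.isTest_pot hg).dd b).dd a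
  have hlap := hC g hg hg0 (ball y (4 * s)) isOpen_ball hgs
  have key : ∀ σ ∈ uIoc δ s, ‖σ * sc ζ σ (lap (dd a (dd b (pot ζ g)))) y‖ ≤
      C * (∫ x, g x) * ∫ z, |ζ z| := by
    intro σ hσ
    rw [uIoc_of_le hδs] at hσ
    have hσ0 : 0 < σ := hδ.trans hσ.1
    have h1 : |sc ζ σ (lap (dd a (dd b (pot ζ g)))) y| ≤ C * (∫ x, g x) * ∫ z, |ζ z| := by
      unfold sc
      rw [← integral_const_mul]
      refine norm_integral_le_of_norm_le
        (f := fun z => lap (dd a (dd b (pot ζ g))) (y - σ • z) * ζ z)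
        (((K.test_ζ.integrable volume).abs).const_mul _) (Eventually.of_forall fun z => ?_)
      simp only [norm_mul, Real.norm_eq_abs]
      by_cases hz : 1 ≤ ‖z‖
      · simp [K.zero_ζ z hz]
      · refine mul_le_mul_of_nonneg_right (hlap _ ?_) (abs_nonneg _)
        push Not at hz
        rw [mem_ball, dist_eq_norm, sub_sub_cancel_left, norm_neg, norm_smul, Real.norm_eq_abs,
          abs_of_pos hσ0]
        nlinarith [hσ.2, norm_nonneg z]
    rw [norm_mul, Real.norm_eq_abs, Real.norm_eq_abs, abs_of_pos hσ0]
    nlinarith [hσ.2, abs_nonneg (sc ζ σ (lap (dd a (dd b (pot ζ g)))) y)]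
  have h2 := intervalIntegral.norm_integral_le_of_norm_le_const key
  rw [← K.sc_sub_sc hh, Real.norm_eq_abs, abs_of_nonneg (sub_nonneg.2 hδs)] at h2
  have h3 : C * (∫ x, g x) * (∫ z, |ζ z|) * (s - δ) ≤ C * (∫ z, |ζ z|) * ∫ x, g x := by
    have : 0 ≤ C * (∫ x, g x) * (∫ z, |ζ z|) := by positivity
    nlinarith
  have h4 := abs_sub_abs_le_abs_sub (sc η δ (dd a (dd b (pot ζ g))) y)
    (sc η s (dd a (dd b (pot ζ g))) y)
  rw [abs_sub_comm] at h4
  linarith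

end KernelPair

/-- A slowly varying radius: comparable to the distance to the complement of `T`. -/
noncomputable def slowRadius (δ : ℝ) (T : Set (Euc d)) (y : Euc d) : ℝ := max δ (infDist y Tᶜ / 4)

lemma abs_slowRadius_sub_le (δ : ℝ) (T : Set (Euc d)) (x y : Euc d) :
    |slowRadius δ T x - slowRadius δ T y| ≤ dist x y / 4 := by
  unfold slowRadius
  rw [max_comm δ, max_comm δ]
  refine (abs_max_sub_max_le_abs _ _ _).trans ?_
  have h1 := infDist_le_infDist_add_dist (s := Tᶜ) (x := x) (y := y)
  have h2 := infDist_le_infDist_add_dist (s := Tᶜ) (x := y) (y := x)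
  rw [dist_comm] at h2
  rw [abs_le]
  constructor <;> linarith

lemma infDist_compl_le_one {T : Set (Euc d)}
    (hT : volume T < volume (ball (0 : Euc d) 1)) (y : Euc d) : infDist y Tᶜ ≤ 1 := by
  by_contra hn
  push Not at hn
  have h1 : ball y 1 ⊆ T := (ball_subset_ball hn.le).trans (ball_infDist_compl_subset)
  have := measure_mono (μ := volume) h1
  rw [Measure.addHaar_ball_center] at this
  exact absurd hT (not_lt.2 this)

lemma nonempty_compl_of_volume_lt {T : Set (Euc d)}
    (hT : volume T < volume (ball (0 : Euc d) 1)) : (Tᶜ).Nonempty := by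
  rw [nonempty_compl]
  rintro rfl
  exact absurd hT (not_lt.2 (measure_mono (subset_univ _)))

lemma measureReal_closedBall_slowRadius_le {ρ : Measure (Euc d)} [IsFiniteMeasure ρ] {t δ : ℝ}
    (hδ : 0 < δ) {T : Set (Euc d)} (hT : volume T < volume (ball (0 : Euc d) 1))
    (hTo : IsOpen T) (hthick : thick ρ t δ ⊆ T) (x : Euc d) :
    ρ.real (closedBall x (2 * slowRadius δ T x)) ≤ 6 ^ d * t * slowRadius δ T x ^ d := by
  obtain ⟨z, hz, hxz⟩ := hTo.isClosed_compl.exists_infDist_eq_dist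
    (nonempty_compl_of_volume_lt hT) x
  set s := slowRadius δ T x with hs
  have h1 : δ ≤ s := le_max_left _ _
  have h2 : infDist x Tᶜ / 4 ≤ s := le_max_right _ _
  have h3 : closedBall x (2 * s) ⊆ closedBall z (6 * s) :=
    closedBall_subset_closedBall' (by linarith)
  have h4 : ¬ t * (6 * s) ^ d < ρ.real (closedBall z (6 * s)) := fun h =>
    hz (hthick ⟨6 * s, by linarith, h⟩)
  refine (measureReal_mono h3).trans ((not_lt.1 h4).trans (le_of_eq ?_))
  rw [mul_pow]
  ring

lemma KernelPair.exists_hessian_bound {η ζ : Euc d → ℝ} (K : KernelPair η ζ) (i j : Fin d) :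
    ∃ C : ℝ, 0 ≤ C ∧ ∀ (ρ : Measure (Euc d)) [IsFiniteMeasure ρ] (t δ m : ℝ) (g : Euc d → ℝ),
      0 < t → 0 < δ → δ ≤ 1 → IsTest g → (∀ x, 0 ≤ g x) → (∀ x, g x ≤ 1) →
      (∀ x ∈ thickening (2 * δ) (thick ρ t δ), g x = 1) → ∫ x, g x ≤ m →
      volume (thickening (2 * δ) (thick ρ t δ)) < volume (ball (0 : Euc d) 1) →
      ∫ y, (dd (ee i) (dd (ee j) (sc η δ (pot ζ g))) y) ^ 2 ∂ρ ≤
        C * (t * m + m ^ 2 * ρ.real univ) := by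
  obtain ⟨C₁, hC₁0, hC₁⟩ := K.exists_sc_dd_pot_bound (ee i) (ee j)
  obtain ⟨B, hB0, hB⟩ := K.test_η.exists_bound
  have hB' : ∀ z, η z ≤ B := fun z => (le_abs_self _).trans (hB z)
  refine ⟨2 * (B * (5 / 4) ^ d * 6 ^ d * 2) + 2 * C₁ ^ 2, by positivity, ?_⟩
  intro ρ _ t δ m g ht hδ hδ1 hg h0 h1 hgT hm hT
  set T := thickening (2 * δ) (thick ρ t δ) with hTdef
  have hm0 : 0 ≤ m := (integral_nonneg h0).trans hm
  have hW := K.isTest_pot hg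
  set h := dd (ee i) (dd (ee j) (pot ζ g)) with hh
  have hhT : IsTest h := (hW.dd _).dd _
  have hh2 : IsTest fun x => h x ^ 2 := by simpa only [sq] using hhT.mul hhT.1
  have e : dd (ee i) (dd (ee j) (sc η δ (pot ζ g))) = sc η δ h := by
    rw [dd_sc K.test_η K.nonneg_η hW, dd_sc K.test_η K.nonneg_η (hW.dd _)]
  have hsct : IsTest (sc η δ h) := isTest_sc K.test_η K.nonneg_η K.zero_η hhT δ
  have hthick : thick ρ t δ ⊆ T := self_subset_thickening (by positivity) _
  have hpos : ∀ y, 0 < slowRadius δ T y := fun y => hδ.trans_le (le_max_left _ _)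
  have hpt : ∀ y, (sc η δ h y) ^ 2 ≤
      2 * sc η (slowRadius δ T y) (fun x => h x ^ 2) y + 2 * (C₁ * m) ^ 2 := by
    intro y
    have hb : |sc η δ h y| ≤ |sc η (slowRadius δ T y) h y| + C₁ * m := by
      rcases le_total (infDist y Tᶜ / 4) δ with hle | hle
      · have : slowRadius δ T y = δ := max_eq_left hle
        rw [this]
        have : 0 ≤ C₁ * m := by positivity
        linarith
      · have hs : slowRadius δ T y = infDist y Tᶜ / 4 := max_eq_right hle
        have hb := hC₁ g hg h0 y δ (slowRadius δ T y) hδ (le_max_left _ _)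
          (by rw [hs]; linarith [infDist_compl_le_one hT y]) (fun x hx => hgT x (by
            rw [hs, mul_div_cancel₀ _ (by norm_num)] at hx
            exact ball_infDist_compl_subset hx))
        have := mul_le_mul_of_nonneg_left hm hC₁0
        linarith
    have hsq := K.sq_sc_le hhT (slowRadius δ T y) y
    have h5 : |sc η δ h y| ^ 2 ≤ (|sc η (slowRadius δ T y) h y| + C₁ * m) ^ 2 :=
      pow_le_pow_left₀ (abs_nonneg _) hb 2
    rw [sq_abs] at h5
    have h6 := sq_abs (sc η (slowRadius δ T y) h y)
    nlinarith [sq_nonneg (|sc η (slowRadius δ T y) h y| - C₁ * m)]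
  have hvar := lintegral_sc_variable_le (G := fun x => h x ^ 2) K.nonneg_η K.test_η K.zero_η hB'
    hB0 hh2 (fun x => sq_nonneg _) hpos (abs_slowRadius_sub_le δ T) (A := 6 ^ d * t) (ρ := ρ)
    (measureReal_closedBall_slowRadius_le hδ hT isOpen_thickening hthick)
  have hL2 : ∫ x, h x ^ 2 ≤ 2 * m := (K.integral_dd_pot_sq_le hg h0 h1 i j).trans (by linarith)
  have hsq_int : IsTest fun y => (sc η δ h y) ^ 2 := by simpa only [sq] using hsct.mul hsct.1
  rw [e, integral_eq_lintegral_of_nonneg_ae (Eventually.of_forall fun y => sq_nonneg _)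
    hsq_int.continuous.aestronglyMeasurable]
  refine ENNReal.toReal_le_of_le_ofReal (by positivity) ?_
  calc ∫⁻ y, ENNReal.ofReal ((sc η δ h y) ^ 2) ∂ρ
      ≤ ∫⁻ y, (2 * ENNReal.ofReal (sc η (slowRadius δ T y) (fun x => h x ^ 2) y) +
          ENNReal.ofReal (2 * (C₁ * m) ^ 2)) ∂ρ := by
        refine lintegral_mono fun y => ?_
        refine (ENNReal.ofReal_le_ofReal (hpt y)).trans (ENNReal.ofReal_add_le.trans ?_)
        rw [ENNReal.ofReal_mul (by norm_num)]
        simp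
    _ = 2 * ∫⁻ y, ENNReal.ofReal (sc η (slowRadius δ T y) (fun x => h x ^ 2) y) ∂ρ +
          ENNReal.ofReal (2 * (C₁ * m) ^ 2) * ρ univ := by
        rw [lintegral_add_right _ measurable_const, lintegral_const,
          lintegral_const_mul' _ _ (by simp)]
    _ ≤ 2 * (ENNReal.ofReal (B * (5 / 4) ^ d * (6 ^ d * t)) * ENNReal.ofReal (2 * m)) +
          ENNReal.ofReal (2 * (C₁ * m) ^ 2) * ρ univ := by
        gcongr
        refine hvar.trans ?_
        gcongr
        rw [← ofReal_integral_eq_lintegral_ofReal (hh2.integrable _)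
          (Eventually.of_forall fun _ => sq_nonneg _)]
        exact ENNReal.ofReal_le_ofReal hL2
    _ = ENNReal.ofReal (2 * (B * (5 / 4) ^ d * (6 ^ d * t) * (2 * m)) +
          2 * (C₁ * m) ^ 2 * ρ.real univ) := by
        have hp : 0 ≤ B * (5 / 4) ^ d * (6 ^ d * t) := by positivity
        rw [ENNReal.ofReal_add (by positivity) (by positivity),
          ENNReal.ofReal_mul (q := B * (5 / 4) ^ d * (6 ^ d * t) * (2 * m)) zero_le_two,
          ENNReal.ofReal_mul hp, ENNReal.ofReal_ofNat,
          ENNReal.ofReal_mul (by positivity : (0 : ℝ) ≤ 2 * (C₁ * m) ^ 2), ofReal_measureReal]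
    _ ≤ _ := by
        refine ENNReal.ofReal_le_ofReal ?_
        have h7 : 0 ≤ 2 * (B * (5 / 4) ^ d * 6 ^ d * 2) * (m ^ 2 * ρ.real univ) := by positivity
        have h8 : 0 ≤ 2 * C₁ ^ 2 * (t * m) := by positivity
        nlinarith

lemma exists_test_function (hd : 0 < d) : ∃ C κ₀ : ℝ, 0 < C ∧ 0 < κ₀ ∧ κ₀ ≤ 1 ∧
    ∀ (ρ : Measure (Euc d)) [IsFiniteMeasure ρ], ρ (closedBall 0 2)ᶜ = 0 →
      ∀ t δ κ : ℝ, 0 < t → 0 < δ → δ ≤ 1 → 0 < κ → κ ≤ κ₀ → C * ρ.real univ / t ≤ κ ^ (d + 1) →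
      ∃ w : Euc d → ℝ, IsTest w ∧ (∀ y, |w y| ≤ C * κ) ∧ (∀ i y, |dd (ee i) w y| ≤ C * κ) ∧
        (∀ y, -(C * κ) ≤ lap w y) ∧ (∀ y ∈ thick ρ t δ, 1 - C * κ ≤ lap w y) ∧
        ∀ i j, ∫ y, (dd (ee i) (dd (ee j) w) y) ^ 2 ∂ρ ≤ C * ρ.real univ := by
  obtain ⟨η, ζ, K⟩ := exists_kernelPair d
  obtain ⟨C₀, hC₀, hcut⟩ := exists_cutoff hd
  obtain ⟨C₁, hC₁, hpot⟩ := K.exists_pot_bound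
  choose C₂ hC₂ hdpot using fun i : Fin d => K.exists_dd_pot_bound (ee i)
  choose C₃ hC₃ hhess using K.exists_hessian_bound
  obtain ⟨B, hB0, hB⟩ := K.test_η.exists_bound
  set S₂ := ∑ i, C₂ i with hS₂
  set S₃ := ∑ i, ∑ j, C₃ i j with hS₃
  have hS₂' : ∀ i, C₂ i ≤ S₂ := fun i =>
    Finset.single_le_sum (fun i _ => hC₂ i) (Finset.mem_univ i)
  have hS₃' : ∀ i j, C₃ i j ≤ S₃ := fun i j =>
    (Finset.single_le_sum (f := C₃ i) (fun j _ => hC₃ i j) (Finset.mem_univ j)).trans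
      (Finset.single_le_sum (f := fun i => ∑ j, C₃ i j)
        (fun i _ => Finset.sum_nonneg fun j _ => hC₃ i j) (Finset.mem_univ i))
  have hS₂0 : 0 ≤ S₂ := Finset.sum_nonneg fun i _ => hC₂ i
  have hS₃0 : 0 ≤ S₃ := Finset.sum_nonneg fun i _ => Finset.sum_nonneg fun j _ => hC₃ i j
  have hv : 0 < volume.real (ball (0 : Euc d) 1) :=
    ENNReal.toReal_pos (measure_ball_pos _ _ one_pos).ne' measure_ball_lt_top.ne
  refine ⟨C₀ + C₁ + S₂ + S₃ * (C₀ + 1) + B, min 1 (volume.real (ball (0 : Euc d) 1) / 2),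
    by positivity, by positivity, min_le_left _ _, ?_⟩
  intro ρ _ hρ t δ κ ht hδ hδ1 hκ hκ0 hκt
  set C := C₀ + C₁ + S₂ + S₃ * (C₀ + 1) + B with hC
  have hCC₀ : C₀ ≤ C := by
    have : 0 ≤ S₃ * (C₀ + 1) := by positivity
    linarith
  obtain ⟨g, hg, h0, h1, hgT, hgm, hT⟩ := hcut ρ hρ t δ ht hδ
  set m := C₀ * ρ.real univ / t with hm
  have hm0 : 0 ≤ m := by positivity
  have hκ1 : κ ≤ 1 := hκ0.trans (min_le_left _ _)
  have hmκ : m ≤ κ ^ (d + 1) := (by rw [hm]; gcongr : m ≤ C * ρ.real univ / t).trans hκt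
  have hκκ : κ ^ (d + 1) ≤ κ := pow_le_of_le_one hκ.le hκ1 (by omega)
  have hgκ := hgm.trans hmκ
  have hTlt : volume (thickening (2 * δ) (thick ρ t δ)) < volume (ball (0 : Euc d) 1) := by
    refine hT.trans_lt ?_
    rw [← ofReal_measureReal (μ := volume) (s := ball (0 : Euc d) 1)]
    refine (ENNReal.ofReal_lt_ofReal_iff hv).2 ?_
    have := hκ0.trans (min_le_right _ _)
    linarith
  have hW := K.isTest_pot hg
  have hηint : ∫ z, |η z| = 1 := by
    simpa only [abs_of_nonneg (K.nonneg_η _)] using K.integral_η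
  have hsc1 : IsTest (sc η 1 g) := isTest_sc K.test_η K.nonneg_η K.zero_η hg 1
  have hlap : ∀ y, lap (sc η δ (pot ζ g)) y = sc η δ g y - sc η δ (sc η 1 g) y := by
    intro y
    have e : lap (sc η δ (pot ζ g)) y = sc η δ (lap (pot ζ g)) y := by
      have := sc_sum Finset.univ K.test_η (G := fun i => dd (ee i) (dd (ee i) (pot ζ g)))
        (fun i => (hW.dd (ee i)).dd (ee i)) δ y
      unfold lap
      rw [this]
      refine Finset.sum_congr rfl fun i _ => ?_
      rw [dd_sc K.test_η K.nonneg_η hW, dd_sc K.test_η K.nonneg_η (hW.dd _)]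
    rw [e, show lap (pot ζ g) = fun x => g x - sc η 1 g x from funext (K.lap_pot hg)]
    generalize sc η 1 g = G at hsc1 ⊢
    unfold sc
    rw [← integral_sub (integrable_sc K.test_η hg.1 δ y) (integrable_sc K.test_η hsc1.1 δ y)]
    congr 1
    funext z
    ring
  have hsc1' : ∀ x, |sc η 1 g x| ≤ B * κ := by
    intro x
    have h := abs_sc_le_scale hB hg one_pos x
    simp only [one_pow, inv_one, mul_one, abs_of_nonneg (h0 _)] at h
    exact h.trans (mul_le_mul_of_nonneg_left (hgκ.trans hκκ) hB0)
  have hsc2 : ∀ y, |sc η δ (sc η 1 g) y| ≤ C * κ := by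
    intro y
    have h := abs_sc_le K.test_η hsc1' δ y
    rw [hηint, mul_one] at h
    refine h.trans (mul_le_mul_of_nonneg_right ?_ hκ.le)
    have : 0 ≤ S₃ * (C₀ + 1) := by positivity
    linarith
  refine ⟨sc η δ (pot ζ g), isTest_sc K.test_η K.nonneg_η K.zero_η hW δ, ?_, ?_, ?_, ?_, ?_⟩
  · intro y
    have h := abs_sc_le K.test_η (hpot g κ hg h0 h1 hκ hκ1 hgκ) δ y
    rw [hηint, mul_one] at h
    refine h.trans (mul_le_mul_of_nonneg_right ?_ hκ.le)
    have : 0 ≤ S₃ * (C₀ + 1) := by positivity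
    linarith
  · intro i y
    have h := abs_sc_le K.test_η (hdpot i g κ hg h0 h1 hκ hκ1 hgκ) δ y
    rw [hηint, mul_one] at h
    rw [dd_sc K.test_η K.nonneg_η hW]
    refine h.trans (mul_le_mul_of_nonneg_right ?_ hκ.le)
    have : 0 ≤ S₃ * (C₀ + 1) := by positivity
    linarith [hS₂' i]
  · intro y
    rw [hlap]
    have := (abs_le.1 (hsc2 y)).2
    have := (K.abs_sc_one_le h0 h1 δ y).1
    linarith
  · intro y hy
    rw [hlap]
    have h3 := (abs_le.1 (hsc2 y)).2
    have h4 : sc η δ g y = 1 := by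
      rw [← K.integral_η]
      unfold sc
      congr 1
      funext z
      by_cases hz : 1 ≤ ‖z‖
      · simp [K.zero_η z hz]
      · push Not at hz
        rw [hgT, one_mul]
        refine mem_thickening_iff.2 ⟨y, hy, ?_⟩
        rw [dist_eq_norm, sub_sub_cancel_left, norm_neg, norm_smul, Real.norm_eq_abs,
          abs_of_pos hδ]
        nlinarith [norm_nonneg z]
    linarith
  · intro i j
    refine (hhess i j ρ t δ m g ht hδ hδ1 hg h0 h1 hgT hgm hTlt).trans ?_
    have e1 : t * m = C₀ * ρ.real univ := by
      rw [hm]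
      field_simp
    have e2 : m ^ 2 ≤ 1 := pow_le_one₀ hm0 (by linarith)
    have e3 : 0 ≤ ρ.real univ := measureReal_nonneg
    calc C₃ i j * (t * m + m ^ 2 * ρ.real univ)
        ≤ S₃ * (C₀ * ρ.real univ + 1 * ρ.real univ) := by
          rw [e1]
          exact mul_le_mul (hS₃' i j) (by gcongr) (by positivity) hS₃0
      _ = S₃ * (C₀ + 1) * ρ.real univ := by ring
      _ ≤ C * ρ.real univ := by
          refine mul_le_mul_of_nonneg_right ?_ e3
          linarith

lemma ae_tendsto_ratio_zero {μ σ : Measure (Euc d)} [IsLocallyFiniteMeasure μ]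
    [IsLocallyFiniteMeasure σ] (h : μ ⟂ₘ σ) :
    ∀ᵐ x ∂σ, Tendsto (fun r => μ (closedBall x r) / σ (closedBall x r)) (𝓝[>] 0) (𝓝 0) := by
  filter_upwards [Besicovitch.ae_tendsto_rnDeriv μ σ, h.rnDeriv_ae_eq_zero] with x hx hx'
  rw [hx'] at hx
  exact hx

lemma thick_antitone (ρ : Measure (Euc d)) (t : ℝ) {δ δ' : ℝ} (h : δ ≤ δ') :
    thick ρ t δ' ⊆ thick ρ t δ :=
  fun _ ⟨s, hs, hs'⟩ => ⟨s, h.trans hs, hs'⟩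

/-- A measure concentrated on a Lebesgue null set `N` only charges thick points of `N`. -/
lemma measure_diff_iUnion_thick {ρ : Measure (Euc d)} [IsFiniteMeasure ρ] {N : Set (Euc d)}
    (hN : MeasurableSet N) (hN0 : volume N = 0) {t : ℝ} (ht : 0 < t) :
    ρ (N \ ⋃ n : ℕ, thick ρ t (1 / (n + 1))) = 0 := by
  have hsing : volume ⟂ₘ ρ.restrict N := ⟨N, hN, hN0, by
    rw [Measure.restrict_apply hN.compl]
    simp⟩
  have h := ae_tendsto_ratio_zero hsing
  rw [ae_restrict_iff' hN] at h
  refine measure_mono_null ?_ h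
  rintro x ⟨hxN, hx⟩ hcontra
  have hlim := hcontra hxN
  apply hx
  set v := volume.real (ball (0 : Euc d) 1) with hv
  have hv0 : 0 < v := ENNReal.toReal_pos (measure_ball_pos _ _ one_pos).ne' measure_ball_lt_top.ne
  have hev := hlim.eventually_lt_const (show (0 : ENNReal) < ENNReal.ofReal (v / t) by
    rw [ENNReal.ofReal_pos]; positivity)
  obtain ⟨r, hr, hr0⟩ := (hev.and self_mem_nhdsWithin).exists
  have hr0 : 0 < r := hr0
  obtain ⟨n, hn⟩ := exists_nat_one_div_lt hr0
  refine mem_iUnion.2 ⟨n, r, hn.le, ?_⟩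
  have h1 : volume (closedBall x r) <
      ENNReal.ofReal (v / t) * ρ.restrict N (closedBall x r) := by
    by_contra hcon
    push Not at hcon
    have hne : ρ.restrict N (closedBall x r) ≠ 0 := by
      intro h0
      rw [h0, ENNReal.div_zero (measure_closedBall_pos _ _ hr0).ne'] at hr
      exact not_top_lt hr
    have := (ENNReal.le_div_iff_mul_le (Or.inl hne) (Or.inl (measure_ne_top _ _))).2 hcon
    exact absurd hr (not_lt.2 this)
  have h2 : volume (closedBall x r) < ENNReal.ofReal (v / t) * ρ (closedBall x r) :=
    h1.trans_le (by gcongr; exact Measure.restrict_le_self)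
  rw [Measure.addHaar_closedBall _ _ hr0.le, finrank_euclideanSpace, Fintype.card_fin,
    ← ofReal_measureReal (μ := volume) (s := ball (0 : Euc d) 1),
    ← ofReal_measureReal (μ := ρ) (s := closedBall x r), ← ENNReal.ofReal_mul (by positivity),
    ← ENNReal.ofReal_mul (by positivity)] at h2
  have h3 := ((ENNReal.ofReal_lt_ofReal_iff_of_nonneg (by positivity)).1 h2)
  rw [← hv, div_mul_eq_mul_div, lt_div_iff₀ ht] at h3
  have h4 : v * (t * r ^ d) < v * ρ.real (closedBall x r) := by linarith
  exact lt_of_mul_lt_mul_left h4 hv0.le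

lemma dd_dd_mul {φ ψ : Euc d → ℝ} (h : ContDiff ℝ ∞ φ) (h' : ContDiff ℝ ∞ ψ) (a b : Euc d)
    (x : Euc d) :
    dd a (dd b fun x => φ x * ψ x) x = φ x * dd a (dd b ψ) x +
      (dd a φ x * dd b ψ x + dd b φ x * dd a ψ x + dd a (dd b φ) x * ψ x) := by
  rw [dd_mul h h', dd_add (h.mul (contDiff_dd h' b)) ((contDiff_dd h b).mul h'),
    dd_mul h (contDiff_dd h' b), dd_mul (contDiff_dd h b) h']
  ring

/-- The spatial cutoff between the unit ball and the ball of radius two. -/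
lemma exists_spatial_cutoff (d : ℕ) : ∃ (χ : Euc d → ℝ) (L : ℝ), IsTest χ ∧ 0 ≤ L ∧
    (∀ x, 0 ≤ χ x) ∧ (∀ x, χ x ≤ 1) ∧ (∀ x ∈ closedBall (0 : Euc d) 1, χ x = 1) ∧
    tsupport χ ⊆ ball 0 2 ∧ (∀ i x, |dd (ee i) χ x| ≤ L) ∧
    ∀ i j x, |dd (ee i) (dd (ee j) χ) x| ≤ L := by
  let χ : ContDiffBump (0 : Euc d) := ⟨1, 3 / 2, by norm_num, by norm_num⟩
  have hχ : IsTest (χ : Euc d → ℝ) := ⟨χ.contDiff, χ.hasCompactSupport⟩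
  choose C₁ h₁ hC₁ using fun i : Fin d => (hχ.dd (ee i)).exists_bound
  choose C₂ h₂ hC₂ using fun i j : Fin d => ((hχ.dd (ee j)).dd (ee i)).exists_bound
  have hS₁ : 0 ≤ ∑ i, C₁ i := Finset.sum_nonneg fun i _ => h₁ i
  have hS₂ : 0 ≤ ∑ i, ∑ j, C₂ i j :=
    Finset.sum_nonneg fun i _ => Finset.sum_nonneg fun j _ => h₂ i j
  refine ⟨χ, (∑ i, C₁ i) + ∑ i, ∑ j, C₂ i j, hχ, by positivity, fun x => χ.nonneg,
    fun x => χ.le_one, fun x hx => χ.one_of_mem_closedBall hx, ?_, fun i x => ?_,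
    fun i j x => ?_⟩
  · rw [χ.tsupport_eq]
    exact closedBall_subset_ball (by norm_num)
  · have := Finset.single_le_sum (fun i _ => h₁ i) (Finset.mem_univ i)
    linarith [hC₁ i x]
  · have h3 := (Finset.single_le_sum (f := C₂ i) (fun j _ => h₂ i j) (Finset.mem_univ j)).trans
      (Finset.single_le_sum (f := fun i => ∑ j, C₂ i j)
        (fun i _ => Finset.sum_nonneg fun j _ => h₂ i j) (Finset.mem_univ i))
    linarith [hC₂ i j x]

/-- A test function whose Laplacian detects the thick part of `ρ`, with small Hessian against
a small weight `w`. -/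
lemma exists_thick_bound (hd : 0 < d) {M : ℝ} (hM : 0 < M) : ∃ C κ₀ : ℝ, 0 < C ∧ 0 < κ₀ ∧
    κ₀ ≤ 1 ∧ ∀ κ, 0 < κ → κ ≤ κ₀ → ∃ τ, 0 < τ ∧
    ∀ (ρ : Measure (Euc d)) [IsFiniteMeasure ρ] (G : Euc d → ℝ) (m : ℝ), 0 < m →
      ρ (closedBall 0 2)ᶜ = 0 → ρ.real univ ≤ M * m → AEStronglyMeasurable G ρ →
      (∀ x, 0 ≤ G x) → (∀ᵐ x ∂ρ, G x ≤ M) → ∫ x, G x ∂ρ ≤ κ ^ 2 * m →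
      (∀ ψ : Euc d → ℝ, IsTest ψ → tsupport ψ ⊆ ball 0 2 →
        |∫ x, lap ψ x ∂ρ| ≤ ∫ x, G x * ∑ i, ∑ j, |dd (ee i) (dd (ee j) ψ) x| ∂ρ) →
      ∀ δ, 0 < δ → δ ≤ 1 →
        ρ.real (closedBall 0 1 ∩ thick ρ (τ * m) δ) ≤ C * κ * m := by
  obtain ⟨C, κ₀, hC, hκ₀, hκ₀1, hex⟩ := exists_test_function hd
  obtain ⟨χ, L, hχ, hL, hχ0, hχ1, hχB, hχs, hdχ, hddχ⟩ := exists_spatial_cutoff d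
  refine ⟨C * M + 3 * d * L * C * M + d ^ 2 * (M / 2 + C * M / 2 + 3 * L * C), κ₀,
    by positivity, hκ₀, hκ₀1, fun κ hκ hκκ₀ => ⟨C * M / κ ^ (d + 1), by positivity, ?_⟩⟩
  intro ρ _ G m hm hρ hρM hGm hG0 hGM hGint hbound δ hδ hδ1
  have hκ1 : κ ≤ 1 := hκκ₀.trans hκ₀1
  set t := C * M / κ ^ (d + 1) * m with ht
  have ht0 : 0 < t := by positivity
  obtain ⟨w, hw, hwb, hdw, hlap0, hlap1, hhess⟩ := hex ρ hρ t δ κ ht0 hδ hδ1 hκ hκκ₀ (by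
    rw [div_le_iff₀ ht0, ht]
    calc C * ρ.real univ ≤ C * (M * m) := by gcongr
      _ = _ := by field_simp)
  have hGi : Integrable G ρ := Integrable.of_bound hGm M (hGM.mono fun x hx => by
    rwa [Real.norm_eq_abs, abs_of_nonneg (hG0 x)])
  have hφ : IsTest fun x => χ x * w x := hχ.mul hw.1
  have hφs : tsupport (fun x => χ x * w x) ⊆ ball 0 2 := (tsupport_mul_subset_left).trans hχs
  have hB := hbound _ hφ hφs
  have herr : ∀ i j x, |dd (ee i) χ x * dd (ee j) w x + dd (ee j) χ x * dd (ee i) w x +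
      dd (ee i) (dd (ee j) χ) x * w x| ≤ 3 * L * C * κ := by
    intro i j x
    have h1 : |dd (ee i) χ x * dd (ee j) w x| ≤ L * (C * κ) := by
      rw [abs_mul]; exact mul_le_mul (hdχ i x) (hdw j x) (abs_nonneg _) hL
    have h2 : |dd (ee j) χ x * dd (ee i) w x| ≤ L * (C * κ) := by
      rw [abs_mul]; exact mul_le_mul (hdχ j x) (hdw i x) (abs_nonneg _) hL
    have h3 : |dd (ee i) (dd (ee j) χ) x * w x| ≤ L * (C * κ) := by
      rw [abs_mul]; exact mul_le_mul (hddχ i j x) (hwb x) (abs_nonneg _) hL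
    linarith [abs_add_three (dd (ee i) χ x * dd (ee j) w x) (dd (ee j) χ x * dd (ee i) w x)
      (dd (ee i) (dd (ee j) χ) x * w x)]
  set A := closedBall (0 : Euc d) 1 ∩ {x | 1 - C * κ ≤ lap w x} with hA
  have hAm : MeasurableSet A := measurableSet_closedBall.inter
    (isClosed_le continuous_const hw.lap.continuous).measurableSet
  have hsub : closedBall 0 1 ∩ thick ρ t δ ⊆ A := fun x hx => ⟨hx.1, hlap1 x hx.2⟩
  have hlow : ρ.real A - (C * κ + d * (3 * L * C * κ)) * ρ.real univ ≤
      ∫ x, lap (fun x => χ x * w x) x ∂ρ := by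
    have hpt : ∀ x, A.indicator (fun _ => (1 : ℝ)) x - (C * κ + d * (3 * L * C * κ)) ≤
        lap (fun x => χ x * w x) x := by
      intro x
      have h1 : A.indicator (fun _ => (1 : ℝ)) x - C * κ ≤ χ x * lap w x := by
        have hCκ : 0 ≤ C * κ := by positivity
        by_cases hx : x ∈ A
        · rw [indicator_of_mem hx, hχB x hx.1, one_mul]
          exact hx.2
        · rw [indicator_of_notMem hx]
          nlinarith [hlap0 x, hχ0 x, hχ1 x]
      have h2 : lap (fun x => χ x * w x) x = χ x * lap w x + ∑ i : Fin d,
          (dd (ee i) χ x * dd (ee i) w x + dd (ee i) χ x * dd (ee i) w x +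
            dd (ee i) (dd (ee i) χ) x * w x) := by
        unfold lap
        simp only [dd_dd_mul hχ.1 hw.1]
        rw [Finset.sum_add_distrib, Finset.mul_sum]
      have h3 : |∑ i : Fin d, (dd (ee i) χ x * dd (ee i) w x + dd (ee i) χ x * dd (ee i) w x +
            dd (ee i) (dd (ee i) χ) x * w x)| ≤ d * (3 * L * C * κ) := by
        refine (Finset.abs_sum_le_sum_abs _ _).trans
          ((Finset.sum_le_sum fun i _ => herr i i x).trans ?_)
        simp
      rw [h2]
      linarith [(abs_le.1 h3).1]
    have hi : Integrable (A.indicator fun _ => (1 : ℝ)) ρ :=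
      (integrable_indicator_iff hAm).2 (integrable_const _).integrableOn
    have hsubi : Integrable (fun x => A.indicator (fun _ => (1 : ℝ)) x -
        (C * κ + d * (3 * L * C * κ))) ρ := hi.sub (integrable_const _)
    have := integral_mono hsubi (hφ.lap.integrable ρ) hpt
    rw [integral_sub hi (integrable_const _), integral_indicator_const _ hAm,
      integral_const] at this
    simpa [mul_comm] using this
  have hup : ∫ x, G x * ∑ i, ∑ j, |dd (ee i) (dd (ee j) fun x => χ x * w x) x| ∂ρ ≤
      d ^ 2 * (M / 2 + C * M / 2 + 3 * L * C) * κ * m := by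
    have hint : ∀ i j : Fin d, Integrable
        (fun x => G x * |dd (ee i) (dd (ee j) fun x => χ x * w x) x|) ρ := fun i j => by
      obtain ⟨B, hB0, hB⟩ := ((hφ.dd (ee j)).dd (ee i)).exists_bound
      exact hGi.mul_bdd (c := B) ((hφ.dd (ee j)).dd (ee i)).continuous.abs.aestronglyMeasurable
        (Eventually.of_forall fun x => by simpa using hB x)
    have hij : ∀ i j : Fin d, ∫ x, G x * |dd (ee i) (dd (ee j) fun x => χ x * w x) x| ∂ρ ≤
        (M / 2 + C * M / 2 + 3 * L * C) * κ * m := by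
      intro i j
      have hH2 : IsTest fun x => (dd (ee i) (dd (ee j) w) x) ^ 2 := by
        simpa only [sq] using ((hw.dd (ee j)).dd (ee i)).mul ((hw.dd (ee j)).dd (ee i)).1
      have hpt : ∀ᵐ x ∂ρ, G x * |dd (ee i) (dd (ee j) fun x => χ x * w x) x| ≤
          (M / (2 * κ) + 3 * L * C * κ) * G x + κ / 2 * (dd (ee i) (dd (ee j) w) x) ^ 2 := by
        filter_upwards [hGM] with x hx
        set H := dd (ee i) (dd (ee j) w) x with hH
        have h1 : |dd (ee i) (dd (ee j) fun x => χ x * w x) x| ≤ |H| + 3 * L * C * κ := by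
          rw [dd_dd_mul hχ.1 hw.1]
          refine (abs_add_le _ _).trans (add_le_add ?_ (herr i j x))
          rw [abs_mul, abs_of_nonneg (hχ0 x)]
          exact mul_le_of_le_one_left (abs_nonneg _) (hχ1 x)
        have h2 : G x * |H| ≤ M / (2 * κ) * G x + κ / 2 * H ^ 2 := by
          have h3 : G x * |H| ≤ (G x) ^ 2 / (2 * κ) + κ / 2 * H ^ 2 := by
            rw [← sq_abs H]
            have : (G x) ^ 2 / (2 * κ) + κ / 2 * |H| ^ 2 - G x * |H| =
                (G x - κ * |H|) ^ 2 / (2 * κ) := by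
              field_simp
              ring
            have h5 : 0 ≤ (G x - κ * |H|) ^ 2 / (2 * κ) := by positivity
            linarith
          have h4 : (G x) ^ 2 / (2 * κ) ≤ M / (2 * κ) * G x := by
            rw [div_mul_eq_mul_div, sq]
            gcongr
            exact hG0 x
          linarith
        nlinarith [mul_le_mul_of_nonneg_left h1 (hG0 x)]
      have hr : Integrable (fun x => (M / (2 * κ) + 3 * L * C * κ) * G x +
          κ / 2 * (dd (ee i) (dd (ee j) w) x) ^ 2) ρ :=
        (hGi.const_mul _).add ((hH2.integrable ρ).const_mul _)
      refine (integral_mono_ae (hint i j) hr hpt).trans ?_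
      rw [integral_add (hGi.const_mul _) ((hH2.integrable ρ).const_mul _), integral_const_mul,
        integral_const_mul]
      have e1 : (M / (2 * κ) + 3 * L * C * κ) * ∫ x, G x ∂ρ ≤
          (M / (2 * κ) + 3 * L * C * κ) * (κ ^ 2 * m) := by gcongr
      have e2 : κ / 2 * ∫ x, (dd (ee i) (dd (ee j) w) x) ^ 2 ∂ρ ≤ κ / 2 * (C * (M * m)) := by
        gcongr
        exact (hhess i j).trans (by gcongr)
      have e3 : (M / (2 * κ) + 3 * L * C * κ) * (κ ^ 2 * m) =
          M / 2 * κ * m + 3 * L * C * κ * m * κ ^ 2 := by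
        field_simp
      have e4 : 3 * L * C * κ * m * κ ^ 2 ≤ 3 * L * C * κ * m :=
        mul_le_of_le_one_right (by positivity) (pow_le_one₀ hκ.le hκ1)
      nlinarith
    simp only [Finset.mul_sum]
    rw [integral_finsetSum _ fun i _ => integrable_finsetSum _ fun j _ => hint i j]
    simp only [integral_finsetSum _ fun j _ => hint _ j]
    refine (Finset.sum_le_sum fun i _ => Finset.sum_le_sum fun j _ => hij i j).trans (le_of_eq ?_)
    simp
    ring
  have h1 : ρ.real (closedBall 0 1 ∩ thick ρ t δ) ≤ ρ.real A := measureReal_mono hsub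
  have h2 := (le_abs_self _).trans hB
  have h3 : (C * κ + d * (3 * L * C * κ)) * ρ.real univ ≤
      (C * κ + d * (3 * L * C * κ)) * (M * m) := by gcongr
  nlinarith

/-- A measure annihilated by the Laplacian up to a small error is not carried by a null set. -/
theorem not_almost_harmonic_singular (hd : 0 < d) {M : ℝ} (hM : 0 < M) : ∃ ε : ℝ, 0 < ε ∧
    ∀ (ρ : Measure (Euc d)) [IsFiniteMeasure ρ] (G : Euc d → ℝ) (N : Set (Euc d)),
      MeasurableSet N → volume N = 0 → 0 < ρ.real (closedBall 0 1) →
      ρ (closedBall 0 2)ᶜ = 0 → ρ.real univ ≤ M * ρ.real (closedBall 0 1) →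
      ρ.real Nᶜ ≤ ε * ρ.real (closedBall 0 1) → AEStronglyMeasurable G ρ →
      (∀ x, 0 ≤ G x) → (∀ᵐ x ∂ρ, G x ≤ M) → ∫ x, G x ∂ρ ≤ ε * ρ.real (closedBall 0 1) →
      (∀ ψ : Euc d → ℝ, IsTest ψ → tsupport ψ ⊆ ball 0 2 →
        |∫ x, lap ψ x ∂ρ| ≤ ∫ x, G x * ∑ i, ∑ j, |dd (ee i) (dd (ee j) ψ) x| ∂ρ) → False := by
  obtain ⟨C, κ₀, hC, hκ₀, hκ₀1, hex⟩ := exists_thick_bound hd hM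
  set κ := min κ₀ (1 / (2 * (C + 1))) with hκ
  have hκ0 : 0 < κ := by positivity
  obtain ⟨τ, hτ, H⟩ := hex κ hκ0 (min_le_left _ _)
  refine ⟨κ ^ 2, by positivity, ?_⟩
  intro ρ _ G N hN hN0 hm hρ hρM hρN hGm hG0 hGM hGint hbound
  set m := ρ.real (closedBall 0 1) with hmdef
  have hδ := fun n : ℕ => H ρ G m hm hρ hρM hGm hG0 hGM hGint hbound (1 / ((n : ℝ) + 1))
    (by positivity) (by
      rw [div_le_one (by positivity)]
      linarith [(Nat.cast_nonneg n : (0 : ℝ) ≤ n)])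
  have hmono : Monotone fun n : ℕ =>
      closedBall (0 : Euc d) 1 ∩ thick ρ (τ * m) (1 / ((n : ℝ) + 1)) :=
    fun a b hab => inter_subset_inter_right _ (thick_antitone ρ _ (by gcongr))
  have hG : ρ.real (⋃ n : ℕ, closedBall 0 1 ∩ thick ρ (τ * m) (1 / ((n : ℝ) + 1))) ≤ C * κ * m := by
    have := (ENNReal.tendsto_toReal (measure_ne_top _ _)).comp
      (tendsto_measure_iUnion_atTop (μ := ρ) hmono)
    exact le_of_tendsto' this hδ
  have hnull := measure_diff_iUnion_thick (ρ := ρ) hN hN0 (show 0 < τ * m by positivity)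
  have hcov : closedBall (0 : Euc d) 1 ⊆
      (⋃ n : ℕ, closedBall 0 1 ∩ thick ρ (τ * m) (1 / ((n : ℝ) + 1))) ∪
        ((N \ ⋃ n : ℕ, thick ρ (τ * m) (1 / ((n : ℝ) + 1))) ∪ Nᶜ) := by
    intro x hx
    rw [← inter_iUnion]
    by_cases h1 : x ∈ ⋃ n : ℕ, thick ρ (τ * m) (1 / ((n : ℝ) + 1))
    · exact Or.inl ⟨hx, h1⟩
    · by_cases h2 : x ∈ N
      · exact Or.inr (Or.inl ⟨h2, h1⟩)
      · exact Or.inr (Or.inr h2)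
  have h1 := (measureReal_mono (μ := ρ) hcov).trans ((measureReal_union_le _ _).trans
    (add_le_add_right (measureReal_union_le _ _) _))
  have h2 : ρ.real (N \ ⋃ n : ℕ, thick ρ (τ * m) (1 / ((n : ℝ) + 1))) = 0 := by
    rw [Measure.real, hnull, ENNReal.toReal_zero]
  rw [h2, ← hmdef] at h1
  have h3 : κ * (2 * (C + 1)) ≤ 1 := by
    have := min_le_right κ₀ (1 / (2 * (C + 1)))
    rwa [← hκ, le_div_iff₀ (by positivity)] at this
  have h4 : κ ^ 2 ≤ κ := by nlinarith [(min_le_left κ₀ (1 / (2 * (C + 1)))).trans hκ₀1]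
  nlinarith

/-- The bilinear form on `ℝ^d` with coefficient matrix `P`. -/
noncomputable def form (P : Matrix (Fin d) (Fin d) ℝ) (a b : Euc d) : ℝ :=
  ∑ i, ∑ j, a i * b j * P i j

theorem form_sub (P Q : Matrix (Fin d) (Fin d) ℝ) (a b : Euc d) :
    form (P - Q) a b = form P a b - form Q a b := by
  simp only [form, Matrix.sub_apply, mul_sub, Finset.sum_sub_distrib]

theorem abs_form_le (P : Matrix (Fin d) (Fin d) ℝ) {a b : Euc d} (ha : ‖a‖ ≤ 1) (hb : ‖b‖ ≤ 1) :
    |form P a b| ≤ ∑ i, ∑ j, |P i j| := by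
  refine (Finset.abs_sum_le_sum_abs _ _).trans (Finset.sum_le_sum fun i _ =>
    (Finset.abs_sum_le_sum_abs _ _).trans (Finset.sum_le_sum fun j _ => ?_))
  rw [abs_mul, abs_mul]
  have h1 : |a i| ≤ 1 := (PiLp.norm_apply_le a i).trans ha
  have h2 : |b j| ≤ 1 := (PiLp.norm_apply_le b j).trans hb
  calc |a i| * |b j| * |P i j| ≤ 1 * 1 * |P i j| := by gcongr
    _ = |P i j| := by ring

theorem exists_diagonalization {P : Matrix (Fin d) (Fin d) ℝ} (hP : P.IsSymm) :
    ∃ (e : OrthonormalBasis (Fin d) ℝ (Euc d)) (ev : Fin d → ℝ),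
      (∀ k l, form P (e k) (e l) = if k = l then ev l else 0) ∧
      ∀ i j, P i j = ∑ k, ev k * (e k i * e k j) := by
  have hH : P.IsHermitian := by
    rw [Matrix.IsHermitian, Matrix.conjTranspose_eq_transpose_of_trivial]; exact hP
  refine ⟨hH.eigenvectorBasis, hH.eigenvalues, fun k l => ?_, fun i j => ?_⟩
  · have h := hH.mulVec_eigenvectorBasis l
    have ho := orthonormal_iff_ite.1 hH.eigenvectorBasis.orthonormal k l
    have h1 : form P (hH.eigenvectorBasis k) (hH.eigenvectorBasis l) =
        ∑ i, hH.eigenvectorBasis k i * (P.mulVec (hH.eigenvectorBasis l).ofLp) i := by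
      simp only [form, Matrix.mulVec, dotProduct, Finset.mul_sum]
      exact Finset.sum_congr rfl fun i _ => Finset.sum_congr rfl fun j _ => by ring
    rw [h1, h]
    rw [PiLp.inner_apply] at ho
    simp only [RCLike.inner_apply, conj_trivial] at ho
    simp only [Pi.smul_apply, smul_eq_mul]
    calc ∑ i, hH.eigenvectorBasis k i * (hH.eigenvalues l * hH.eigenvectorBasis l i)
        = hH.eigenvalues l * ∑ i, hH.eigenvectorBasis l i * hH.eigenvectorBasis k i := by
          rw [Finset.mul_sum]; exact Finset.sum_congr rfl fun i _ => by ring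
      _ = _ := by rw [ho]; split_ifs <;> simp
  · have h := hH.eigenvectorBasis.sum_repr' (ee j)
    have h2 : ∀ k, inner ℝ (hH.eigenvectorBasis k) (ee j) = hH.eigenvectorBasis k j := fun k => by
      simp [EuclideanSpace.inner_single_right]
    have h3 : P i j = P.mulVec (ee j : Euc d).ofLp i := by
      simp [Matrix.mulVec, dotProduct]
    rw [h3, ← h]
    simp only [h2, WithLp.ofLp_sum, WithLp.ofLp_smul, Matrix.mulVec_sum, Matrix.mulVec_smul,
      hH.mulVec_eigenvectorBasis, Finset.sum_apply, Pi.smul_apply, smul_eq_mul]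
    exact Finset.sum_congr rfl fun k _ => by ring

/-- A symmetric matrix which is not a symmetrized tensor product of nonzero vectors has two
eigenvalues of the same strict sign. -/
theorem exists_same_sign {P : Matrix (Fin d) (Fin d) ℝ} (hP0 : P ≠ 0)
    (hP : ¬ ∃ a b : Fin d → ℝ, a ≠ 0 ∧ b ≠ 0 ∧ ∀ i j, P i j = (a i * b j + b i * a j) / 2)
    {e : Fin d → Euc d} {ev : Fin d → ℝ} (hev : ∀ i j, P i j = ∑ k, ev k * (e k i * e k j)) :
    ∃ p q, p ≠ q ∧ 0 < ev p * ev q := by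
  by_contra hcon
  push Not at hcon
  have key : ∀ a b : Fin d → ℝ, ¬ ∀ i j, P i j = (a i * b j + b i * a j) / 2 := by
    refine fun a b h => hP ⟨a, b, ?_, ?_, h⟩
    · rintro rfl; exact hP0 (by ext i j; simp [h i j])
    · rintro rfl; exact hP0 (by ext i j; simp [h i j])
  obtain ⟨p, hp⟩ : ∃ p, ev p ≠ 0 := by
    by_contra h
    push Not at h
    exact hP0 (by ext i j; simp [hev i j, h])
  by_cases hq : ∃ q, q ≠ p ∧ ev q ≠ 0
  · obtain ⟨q, hqp, hq⟩ := hq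
    have hpq : ev p * ev q < 0 :=
      lt_of_le_of_ne (hcon p q hqp.symm) (mul_ne_zero hp hq)
    have hr : ∀ r, r ≠ p → r ≠ q → ev r = 0 := by
      intro r h1 h2
      by_contra h3
      have h4 := hcon r p h1
      have h5 := hcon r q h2
      have h6 : 0 ≤ ev r ^ 2 * (ev p * ev q) := by nlinarith [mul_nonneg_of_nonpos_of_nonpos h4 h5]
      have : 0 < ev r ^ 2 := by positivity
      nlinarith
    have hsum : ∀ i j, P i j = ev p * (e p i * e p j) + ev q * (e q i * e q j) := by
      intro i j
      rw [hev i j, Finset.sum_eq_add p q hqp.symm (fun r _ h => by rw [hr r h.1 h.2, zero_mul])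
        (by simp) (by simp)]
    rcases lt_or_gt_of_ne hp with hp' | hp'
    · have hq' : 0 < ev q := by nlinarith
      have e1 := Real.sq_sqrt (neg_pos.2 hp').le
      have e2 := Real.sq_sqrt hq'.le
      refine key (fun i => √(ev q) * e q i + √(-ev p) * e p i)
        (fun i => √(ev q) * e q i - √(-ev p) * e p i) fun i j => ?_
      rw [hsum i j]
      linear_combination (e p i * e p j) * e1 - (e q i * e q j) * e2
    · have hq' : ev q < 0 := by nlinarith
      have e1 := Real.sq_sqrt (neg_pos.2 hq').le
      have e2 := Real.sq_sqrt hp'.le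
      refine key (fun i => √(ev p) * e p i + √(-ev q) * e q i)
        (fun i => √(ev p) * e p i - √(-ev q) * e q i) fun i j => ?_
      rw [hsum i j]
      linear_combination (e q i * e q j) * e1 - (e p i * e p j) * e2
  · push Not at hq
    refine key (fun i => ev p * e p i) (fun i => e p i) fun i j => ?_
    rw [hev i j, Finset.sum_eq_single p (fun r _ h => by rw [hq r h, zero_mul]) (by simp)]
    ring

/-- The coefficients of the elliptic combination of the Saint-Venant equations. -/
theorem exists_elliptic_coeff {ev : Fin d → ℝ} {p q : Fin d} (hpq : p ≠ q)
    (h : 0 < ev p * ev q) :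
    ∃ c A : Fin d → ℝ, (∀ k, 0 < A k) ∧ c p = 0 ∧ (∀ k, k ≠ p → A k = c k * ev p) ∧
      A p = ∑ k, c k * ev k := by
  have hp : ev p ≠ 0 := by rintro h0; simp [h0] at h
  set s : ℝ := ∑ k ∈ Finset.univ.erase q, (if k = p then 0 else ev k / ev p) with hs
  have hr : 0 < ev q / ev p := by
    have : ev q / ev p = ev p * ev q / ev p ^ 2 := by field_simp
    rw [this]; positivity
  set g : ℝ := (|s| + 1) / (ev q / ev p) with hg
  have hg0 : 0 < g := by positivity
  set c : Fin d → ℝ := fun k => if k = p then 0 else if k = q then g / ev p else 1 / ev p with hc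
  have hsum : ∑ k, c k * ev k = |s| + 1 + s := by
    rw [← Finset.add_sum_erase _ _ (Finset.mem_univ q)]
    congr 1
    · simp only [hc, if_neg hpq.symm, if_true, hg]
      have : ev q ≠ 0 := by rintro h0; simp [h0] at h
      field_simp
    · refine Finset.sum_congr rfl fun k hk => ?_
      simp only [hc, if_neg (Finset.ne_of_mem_erase hk)]
      split_ifs <;> ring
  refine ⟨c, fun k => if k = p then ∑ k, c k * ev k else c k * ev p, fun k => ?_, by simp [hc],
    fun k hk => by simp [hk], by simp⟩
  by_cases hk : k = p
  · simp only [hk, if_true, hsum]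
    linarith [neg_abs_le s]
  · simp only [hk, if_false, hc]
    split_ifs <;> field_simp <;> positivity

theorem dd_eq_sum (v : Euc d) (φ : Euc d → ℝ) (x : Euc d) :
    dd v φ x = ∑ i, v i * dd (ee i) φ x := by
  have hv : v = ∑ i, v i • (ee i : Euc d) := by
    have := (EuclideanSpace.basisFun (Fin d) ℝ).sum_repr v
    simpa using this.symm
  calc dd v φ x = fderiv ℝ φ x (∑ i, v i • (ee i : Euc d)) := by rw [← hv]; rfl
    _ = _ := by simp [dd, map_sum]

theorem integrable_form {ρ : Measure (Euc d)} {f : Euc d → Matrix (Fin d) (Fin d) ℝ}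
    (hf : ∀ i j, Integrable (fun x => f x i j) ρ) (a b : Euc d) :
    Integrable (fun x => form (f x) a b) ρ :=
  integrable_finsetSum _ fun i _ => integrable_finsetSum _ fun j _ => (hf i j).const_mul _

theorem IsTest.integrable_mul {m : Measure (Euc d)} {φ g : Euc d → ℝ} (h : IsTest φ)
    (hg : Integrable g m) : Integrable (fun x => φ x * g x) m := by
  obtain ⟨C, _, hC⟩ := h.exists_bound
  exact hg.bdd_mul h.continuous.aestronglyMeasurable (Eventually.of_forall hC)

theorem IsTest.integrable_mul_right {m : Measure (Euc d)} {φ g : Euc d → ℝ} (h : IsTest φ)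
    (hg : Integrable g m) : Integrable (fun x => g x * φ x) m := by
  simpa [mul_comm] using h.integrable_mul hg

/-- The defining relation of the symmetrized gradient, tested with arbitrary directions. -/
theorem symmetrized_gradient_form {Ω : Set (Euc d)} {u : Euc d → Euc d} {ρ : Measure (Euc d)}
    {f : Euc d → Matrix (Fin d) (Fin d) ℝ} (hu : ∀ i, IntegrableOn (fun x => u x i) Ω volume)
    (hf : ∀ i j, Integrable (fun x => f x i j) ρ) {φ : Euc d → ℝ} (hφ : IsTest φ)
    (hE : ∀ i j, ∫ x in Ω, (u x i * dd (ee j) φ x + u x j * dd (ee i) φ x) / 2 =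
      -∫ x, φ x * f x i j ∂ρ) (a b : Euc d) :
    ∫ x in Ω, ((∑ i, a i * u x i) * dd b φ x + (∑ i, b i * u x i) * dd a φ x) / 2 =
      -∫ x, φ x * form (f x) a b ∂ρ := by
  have hi : ∀ i j, IntegrableOn
      (fun x => (u x i * dd (ee j) φ x + u x j * dd (ee i) φ x) / 2) Ω volume := fun i j =>
    (((hφ.dd _).integrable_mul_right (hu i)).add ((hφ.dd _).integrable_mul_right (hu j))).div_const
      2
  have h1 : ∀ x, ((∑ i, a i * u x i) * dd b φ x + (∑ i, b i * u x i) * dd a φ x) / 2 =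
      ∑ i, ∑ j, a i * b j * ((u x i * dd (ee j) φ x + u x j * dd (ee i) φ x) / 2) := by
    intro x
    rw [dd_eq_sum a, dd_eq_sum b, mul_comm (∑ i, b i * u x i), Finset.sum_mul_sum,
      Finset.sum_mul_sum, ← Finset.sum_add_distrib, Finset.sum_div]
    refine Finset.sum_congr rfl fun i _ => ?_
    rw [← Finset.sum_add_distrib, Finset.sum_div]
    exact Finset.sum_congr rfl fun j _ => by ring
  have h2 : ∀ x, φ x * form (f x) a b = ∑ i, ∑ j, a i * b j * (φ x * f x i j) := by
    intro x
    simp only [form, Finset.mul_sum]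
    exact Finset.sum_congr rfl fun i _ => Finset.sum_congr rfl fun j _ => by ring
  simp only [h1, h2]
  rw [integral_finsetSum _ fun i _ => integrable_finsetSum _ fun j _ => (hi i j).const_mul _,
    integral_finsetSum _ fun i _ => integrable_finsetSum _ fun j _ =>
      (hφ.integrable_mul (hf i j)).const_mul _, ← Finset.sum_neg_distrib]
  refine Finset.sum_congr rfl fun i _ => ?_
  rw [integral_finsetSum _ fun j _ => (hi i j).const_mul _,
    integral_finsetSum _ fun j _ => (hφ.integrable_mul (hf i j)).const_mul _,
    ← Finset.sum_neg_distrib]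
  refine Finset.sum_congr rfl fun j _ => ?_
  rw [integral_const_mul, integral_const_mul, hE i j, mul_neg]

/-- The Saint-Venant compatibility relations. -/
theorem saint_venant {Ω : Set (Euc d)} {u : Euc d → Euc d} {ρ : Measure (Euc d)}
    {f : Euc d → Matrix (Fin d) (Fin d) ℝ} (hu : ∀ i, IntegrableOn (fun x => u x i) Ω volume)
    (hf : ∀ i j, Integrable (fun x => f x i j) ρ)
    (hE : ∀ φ : Euc d → ℝ, IsTest φ → tsupport φ ⊆ Ω → ∀ i j,
      ∫ x in Ω, (u x i * dd (ee j) φ x + u x j * dd (ee i) φ x) / 2 = -∫ x, φ x * f x i j ∂ρ)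
    {φ : Euc d → ℝ} (hφ : IsTest φ) (hφΩ : tsupport φ ⊆ Ω) (a b : Euc d) :
    ∫ x, (dd a (dd a φ) x * form (f x) b b + dd b (dd b φ) x * form (f x) a a -
      2 * (dd a (dd b φ) x * form (f x) a b)) ∂ρ = 0 := by
  have hs : ∀ v w : Euc d, tsupport (dd v (dd w φ)) ⊆ Ω := fun v w =>
    (tsupport_dd_subset _ _).trans ((tsupport_dd_subset _ _).trans hφΩ)
  have key : ∀ v w a b : Euc d, _ := fun v w => symmetrized_gradient_form hu hf
    ((hφ.dd w).dd v) (hE _ ((hφ.dd w).dd v) (hs v w))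
  have hi : ∀ a v w z : Euc d,
      IntegrableOn (fun x => (∑ i, a i * u x i) * dd z (dd v (dd w φ)) x) Ω volume :=
    fun a v w z => (((hφ.dd w).dd v).dd z).integrable_mul_right
      (integrable_finsetSum _ fun i _ => (hu i).const_mul _)
  have hint : ∀ a b v w : Euc d, Integrable (fun x => dd v (dd w φ) x * form (f x) a b) ρ :=
    fun a b v w => ((hφ.dd w).dd v).integrable_mul (integrable_form hf a b)
  have hadd : Integrable (fun x => dd a (dd a φ) x * form (f x) b b +
      dd b (dd b φ) x * form (f x) a a) ρ := (hint b b a a).add (hint a a b b)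
  rw [integral_sub hadd ((hint a b a b).const_mul 2),
    integral_add (hint b b a a) (hint a a b b), integral_const_mul]
  have k1 := key a a b b
  have k2 := key b b a a
  have k3 := key a b a b
  have c1 : dd b (dd a (dd a φ)) = dd a (dd a (dd b φ)) := by
    rw [dd_comm (hφ.dd a).1, dd_comm hφ.1]
  have c2 : dd b (dd a (dd b φ)) = dd a (dd b (dd b φ)) := by
    rw [dd_comm (hφ.dd b).1]
  have e1 : ∫ x in Ω, ((∑ i, b i * u x i) * dd b (dd a (dd a φ)) x +
      (∑ i, b i * u x i) * dd b (dd a (dd a φ)) x) / 2 =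
      ∫ x in Ω, (∑ i, b i * u x i) * dd a (dd a (dd b φ)) x := by
    rw [c1]; congr 1; ext x; ring
  have e2 : ∫ x in Ω, ((∑ i, a i * u x i) * dd a (dd b (dd b φ)) x +
      (∑ i, a i * u x i) * dd a (dd b (dd b φ)) x) / 2 =
      ∫ x in Ω, (∑ i, a i * u x i) * dd a (dd b (dd b φ)) x := by
    congr 1; ext x; ring
  rw [e1] at k1
  rw [e2] at k2
  rw [c2, integral_div, integral_add (hi a b b a) (hi b a b a)] at k3
  linarith

theorem dd_smul (c : ℝ) (v : Euc d) (φ : Euc d → ℝ) : dd (c • v) φ = fun x => c * dd v φ x := by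
  funext x
  simp [dd]

theorem dd_const_mul {φ : Euc d → ℝ} (h : ContDiff ℝ ∞ φ) (c : ℝ) (v : Euc d) :
    dd v (fun x => c * φ x) = fun x => c * dd v φ x := by
  funext x
  simp [dd, fderiv_const_mul (differentiable_of_smooth h x)]

/-- If `P` is symmetric and not a symmetrized tensor product, the Saint-Venant relations frozen at
`P` contain an elliptic equation. -/
theorem exists_elliptic_equation {P : Matrix (Fin d) (Fin d) ℝ} (hPs : P.IsSymm) (hP0 : P ≠ 0)
    (hP : ¬ ∃ a b : Fin d → ℝ, a ≠ 0 ∧ b ≠ 0 ∧ ∀ i j, P i j = (a i * b j + b i * a j) / 2) :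
    0 < d ∧ ∃ (T : Euc d ≃L[ℝ] Euc d) (C : ℝ), 0 ≤ C ∧
      ∀ (ρ : Measure (Euc d)) [IsFiniteMeasure ρ] (f : Euc d → Matrix (Fin d) (Fin d) ℝ),
        (∀ i j, Integrable (fun x => f x i j) ρ) → ∀ φ : Euc d → ℝ, IsTest φ →
        (∀ a b : Euc d, ∫ x, (dd a (dd a φ) x * form (f x) b b + dd b (dd b φ) x * form (f x) a a -
          2 * (dd a (dd b φ) x * form (f x) a b)) ∂ρ = 0) →
        |∫ x, ∑ k, dd (T.symm (ee k)) (dd (T.symm (ee k)) φ) x ∂ρ| ≤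
          ∫ x, C * (∑ i, ∑ j, |f x i j - P i j|) *
            ∑ k, ∑ l, |dd (T.symm (ee k)) (dd (T.symm (ee l)) φ) x| ∂ρ := by
  obtain ⟨e, ev, he, hev⟩ := exists_diagonalization hPs
  obtain ⟨p, q, hpq, hpos⟩ := exists_same_sign hP0 hP hev
  obtain ⟨c, A, hA, hcp, hA1, hA2⟩ := exists_elliptic_coeff hpq hpos
  refine ⟨p.pos, ?_⟩
  set s : Fin d → ℝ := fun k => √(A k) with hs
  have hs0 : ∀ k, 0 < s k := fun k => Real.sqrt_pos.2 (hA k)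
  have hss : ∀ k, s k * s k = A k := fun k => Real.mul_self_sqrt (hA k).le
  obtain ⟨T, hT⟩ : ∃ T : Euc d ≃L[ℝ] Euc d, ∀ k, T.symm (ee k) = s k • e k := by
    let B := e.toBasis.unitsSMul fun k => Units.mk0 (s k) (hs0 k).ne'
    refine ⟨((EuclideanSpace.basisFun (Fin d) ℝ).toBasis.equiv B
      (Equiv.refl _)).toContinuousLinearEquiv.symm, fun k => ?_⟩
    have h1 : (ee k : Euc d) = (EuclideanSpace.basisFun (Fin d) ℝ).toBasis k := by simp
    rw [ContinuousLinearEquiv.symm_symm, LinearEquiv.coe_toContinuousLinearEquiv', h1,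
      Module.Basis.equiv_apply]
    simp [B, Module.Basis.unitsSMul_apply, Units.smul_def]
  set K : ℝ := ∑ k, ∑ l, (s k * s l)⁻¹ with hK
  have hK1 : ∀ k l, (s k * s l)⁻¹ ≤ K := fun k l =>
    (Finset.single_le_sum (f := fun l => (s k * s l)⁻¹)
      (fun l _ => (inv_pos.2 (mul_pos (hs0 k) (hs0 l))).le) (Finset.mem_univ l)).trans
    (Finset.single_le_sum (f := fun k => ∑ l, (s k * s l)⁻¹) (fun k _ => Finset.sum_nonneg
      fun l _ => (inv_pos.2 (mul_pos (hs0 k) (hs0 l))).le) (Finset.mem_univ k))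
  have hK0 : 0 ≤ K := Finset.sum_nonneg fun k _ => Finset.sum_nonneg
    fun l _ => (inv_pos.2 (mul_pos (hs0 k) (hs0 l))).le
  refine ⟨T, ∑ k, |c k| * (4 * K), Finset.sum_nonneg fun k _ => by positivity, ?_⟩
  intro ρ _ f hf φ hφ hsv
  have hD : ∀ k l x, dd (T.symm (ee k)) (dd (T.symm (ee l)) φ) x =
      s k * s l * dd (e k) (dd (e l) φ) x := by
    intro k l x
    rw [hT, hT, dd_smul, dd_smul, dd_const_mul (hφ.dd _).1]
    ring
  set D : Euc d → ℝ := fun x => ∑ k, ∑ l, |dd (T.symm (ee k)) (dd (T.symm (ee l)) φ) x| with hDdef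
  have hDle : ∀ k l x, |dd (e k) (dd (e l) φ) x| ≤ K * D x := by
    intro k l x
    have h1 : |dd (T.symm (ee k)) (dd (T.symm (ee l)) φ) x| ≤ D x :=
      (Finset.single_le_sum (f := fun l => |dd (T.symm (ee k)) (dd (T.symm (ee l)) φ) x|)
        (fun l _ => abs_nonneg _) (Finset.mem_univ l)).trans
      (Finset.single_le_sum (f := fun k => ∑ l, |dd (T.symm (ee k)) (dd (T.symm (ee l)) φ) x|)
        (fun k _ => Finset.sum_nonneg fun l _ => abs_nonneg _) (Finset.mem_univ k))
    have hpos := mul_pos (hs0 k) (hs0 l)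
    have h2 : dd (e k) (dd (e l) φ) x =
        (s k * s l)⁻¹ * dd (T.symm (ee k)) (dd (T.symm (ee l)) φ) x := by
      rw [hD, inv_mul_cancel_left₀ hpos.ne']
    rw [h2, abs_mul, abs_of_pos (inv_pos.2 hpos)]
    exact mul_le_mul (hK1 k l) h1 (abs_nonneg _) hK0
  set Q : Fin d → Matrix (Fin d) (Fin d) ℝ → Euc d → ℝ := fun k F x =>
    dd (e p) (dd (e p) φ) x * form F (e k) (e k) + dd (e k) (dd (e k) φ) x * form F (e p) (e p) -
      2 * (dd (e p) (dd (e k) φ) x * form F (e p) (e k)) with hQ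
  have hQi : ∀ k, Integrable (fun x => Q k (f x) x) ρ := fun k =>
    ((((hφ.dd _).dd _).integrable_mul (integrable_form hf _ _)).add
      (((hφ.dd _).dd _).integrable_mul (integrable_form hf _ _))).sub
      ((((hφ.dd _).dd _).integrable_mul (integrable_form hf _ _)).const_mul 2)
  have hQ0 : ∫ x, ∑ k, c k * Q k (f x) x ∂ρ = 0 := by
    rw [integral_finsetSum _ fun k _ => (hQi k).const_mul _]
    exact Finset.sum_eq_zero fun k _ => by rw [integral_const_mul, hQ, hsv, mul_zero]
  have hQP : ∀ x, ∑ k, c k * Q k P x = ∑ k, dd (T.symm (ee k)) (dd (T.symm (ee k)) φ) x := by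
    intro x
    have h1 : ∀ k, c k * Q k P x = c k * ev k * dd (e p) (dd (e p) φ) x +
        c k * ev p * dd (e k) (dd (e k) φ) x := by
      intro k
      by_cases hk : k = p
      · simp [hk, hcp]
      · simp only [hQ, he, if_true, if_neg (Ne.symm hk)]
        ring
    have h2 : ∀ k, dd (T.symm (ee k)) (dd (T.symm (ee k)) φ) x =
        (if k = p then A p * dd (e p) (dd (e p) φ) x else 0) +
        c k * ev p * dd (e k) (dd (e k) φ) x := by
      intro k
      rw [hD, hss]
      by_cases hk : k = p
      · simp [hk, hcp]
      · simp [hk, hA1 k hk]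
    simp only [h1, h2, Finset.sum_add_distrib, Finset.sum_ite_eq', Finset.mem_univ, if_true,
      hA2, Finset.sum_mul]
  have hQsub : ∀ k F G x, Q k F x - Q k G x = Q k (F - G) x := by
    intro k F G x
    simp only [hQ, form_sub]
    ring
  have hQle : ∀ k F x, |Q k F x| ≤ 4 * K * (∑ i, ∑ j, |F i j|) * D x := by
    intro k F x
    have hn : ∀ k, ‖e k‖ ≤ 1 := fun k => (e.orthonormal.1 k).le
    have b : ∀ k l m n, |dd (e k) (dd (e l) φ) x * form F (e m) (e n)| ≤
        K * D x * ∑ i, ∑ j, |F i j| := fun k l m n => by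
      rw [abs_mul]
      exact mul_le_mul (hDle k l x) (abs_form_le F (hn m) (hn n)) (abs_nonneg _)
        ((abs_nonneg _).trans (hDle k l x))
    have b1 := abs_le.1 (b p p k k)
    have b2 := abs_le.1 (b k k p p)
    have b3 := abs_le.1 (b p k p k)
    rw [abs_le]
    simp only [hQ]
    constructor <;> linarith [b1.1, b1.2, b2.1, b2.2, b3.1, b3.2]
  have hLi : Integrable (fun x => ∑ k, dd (T.symm (ee k)) (dd (T.symm (ee k)) φ) x) ρ :=
    integrable_finsetSum _ fun k _ => ((hφ.dd _).dd _).integrable ρ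
  have hSi : Integrable (fun x => ∑ k, c k * Q k (f x) x) ρ :=
    integrable_finsetSum _ fun k _ => (hQi k).const_mul _
  have hDi : Integrable (fun x =>
      (∑ k, |c k| * (4 * K)) * (∑ i, ∑ j, |f x i j - P i j|) * D x) ρ := by
    have h1 : Integrable (fun x => (∑ k, |c k| * (4 * K)) * (∑ i, ∑ j, |f x i j - P i j|)) ρ :=
      (integrable_finsetSum _ fun i _ => integrable_finsetSum _ fun j _ =>
        ((hf i j).sub (integrable_const _)).abs).const_mul _
    choose B _ hB using fun k l => ((hφ.dd (T.symm (ee l))).dd (T.symm (ee k))).exists_bound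
    refine h1.mul_bdd (c := ∑ k, ∑ l, B k l) (Continuous.aestronglyMeasurable
      (continuous_finsetSum _ fun k _ => continuous_finsetSum _ fun l _ =>
        ((hφ.dd _).dd _).continuous.abs)) (Eventually.of_forall fun x => ?_)
    rw [Real.norm_of_nonneg (Finset.sum_nonneg fun k _ => Finset.sum_nonneg fun l _ =>
      abs_nonneg _)]
    exact Finset.sum_le_sum fun k _ => Finset.sum_le_sum fun l _ => hB k l x
  calc |∫ x, ∑ k, dd (T.symm (ee k)) (dd (T.symm (ee k)) φ) x ∂ρ|
      = |∫ x, (∑ k, dd (T.symm (ee k)) (dd (T.symm (ee k)) φ) x - ∑ k, c k * Q k (f x) x) ∂ρ| := by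
        rw [integral_sub hLi hSi, hQ0, sub_zero]
    _ ≤ ∫ x, |∑ k, dd (T.symm (ee k)) (dd (T.symm (ee k)) φ) x - ∑ k, c k * Q k (f x) x| ∂ρ :=
        abs_integral_le_integral_abs
    _ ≤ _ := by
        refine integral_mono (hLi.sub hSi).abs hDi fun x => ?_
        rw [abs_sub_comm, ← hQP x, ← Finset.sum_sub_distrib]
        simp only [← mul_sub, hQsub]
        refine (Finset.abs_sum_le_sum_abs _ _).trans ?_
        rw [Finset.sum_mul, Finset.sum_mul]
        refine Finset.sum_le_sum fun k _ => ?_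
        rw [abs_mul]
        calc |c k| * |Q k (f x - P) x| ≤ |c k| * (4 * K * (∑ i, ∑ j, |(f x - P) i j|) * D x) := by
              gcongr; exact hQle _ _ _
          _ = _ := by simp only [Matrix.sub_apply]; ring

/-- The affine change of variables `x ↦ r⁻¹ T (x - x₀)`. -/
noncomputable def blowup (T : Euc d ≃L[ℝ] Euc d) (x₀ : Euc d) {r : ℝ} (hr : r ≠ 0) :
    Euc d ≃ₜ Euc d :=
  (Homeomorph.subRight x₀).trans
    (T.toHomeomorph.trans (Homeomorph.smulOfNeZero r⁻¹ (inv_ne_zero hr)))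

theorem blowup_apply (T : Euc d ≃L[ℝ] Euc d) (x₀ : Euc d) {r : ℝ} (hr : r ≠ 0) (x : Euc d) :
    blowup T x₀ hr x = r⁻¹ • T (x - x₀) := rfl

theorem hasFDerivAt_blowup (T : Euc d ≃L[ℝ] Euc d) (x₀ : Euc d) {r : ℝ} (hr : r ≠ 0) (x : Euc d) :
    HasFDerivAt (blowup T x₀ hr) (r⁻¹ • (T : Euc d →L[ℝ] Euc d)) x := by
  have h := ((T : Euc d →L[ℝ] Euc d).hasFDerivAt.comp x
    ((hasFDerivAt_id x).sub_const x₀)).const_smul r⁻¹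
  simpa using! h

theorem IsTest.comp_blowup {ψ : Euc d → ℝ} (h : IsTest ψ) (T : Euc d ≃L[ℝ] Euc d) (x₀ : Euc d)
    {r : ℝ} (hr : r ≠ 0) : IsTest (ψ ∘ blowup T x₀ hr) := by
  refine ⟨h.1.comp ?_, h.2.comp_homeomorph _⟩
  have : ContDiff ℝ ∞ fun x => r⁻¹ • T (x - x₀) :=
    (T.contDiff.comp (contDiff_id.sub contDiff_const)).const_smul r⁻¹
  exact this

theorem dd_comp_blowup {ψ : Euc d → ℝ} (h : ContDiff ℝ ∞ ψ) (T : Euc d ≃L[ℝ] Euc d) (x₀ : Euc d)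
    {r : ℝ} (hr : r ≠ 0) (v : Euc d) :
    dd (T.symm v) (ψ ∘ blowup T x₀ hr) = fun x => r⁻¹ * (dd v ψ ∘ blowup T x₀ hr) x := by
  funext x
  have h1 := (differentiable_of_smooth h (blowup T x₀ hr x)).hasFDerivAt.comp x
    (hasFDerivAt_blowup T x₀ hr x)
  simp [dd, h1.fderiv]

theorem dd_dd_comp_blowup {ψ : Euc d → ℝ} (h : IsTest ψ) (T : Euc d ≃L[ℝ] Euc d) (x₀ : Euc d)
    {r : ℝ} (hr : r ≠ 0) (v w : Euc d) (x : Euc d) :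
    dd (T.symm v) (dd (T.symm w) (ψ ∘ blowup T x₀ hr)) x =
      r⁻¹ ^ 2 * dd v (dd w ψ) (blowup T x₀ hr x) := by
  rw [dd_comp_blowup h.1, dd_const_mul ((h.dd w).comp_blowup T x₀ hr).1,
    dd_comp_blowup (h.dd w).1]
  simp only [Function.comp_apply]
  ring

/-- A measure with positive lower density is doubling along a sequence of radii. -/
theorem exists_doubling_radius {ρ : Measure (Euc d)} [IsFiniteMeasure ρ] {x₀ : Euc d}
    (hvol : ∀ᶠ r in 𝓝[>] 0, volume.real (closedBall x₀ r) ≤ ρ.real (closedBall x₀ r))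
    {K : ℝ} (hK : 1 < K) {δ : ℝ} (hδ : 0 < δ) :
    ∃ r, 0 < r ∧ r < δ ∧
      ρ.real (closedBall x₀ (K * r)) ≤ 2 * K ^ d * ρ.real (closedBall x₀ r) := by
  by_contra hcon
  push Not at hcon
  obtain ⟨δ', hδ', hv⟩ := (nhdsGT_basis (0 : ℝ)).eventually_iff.1 hvol
  have hK0 : 0 < K := one_pos.trans hK
  set r₀ := min δ δ' / 2 with hr₀
  have hr0 : 0 < r₀ := by positivity
  have hlt : r₀ < min δ δ' := half_lt_self (by positivity)
  set v := volume.real (ball (0 : Euc d) 1) with hvdef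
  have hv0 : 0 < v := ENNReal.toReal_pos (measure_ball_pos _ _ one_pos).ne' measure_ball_lt_top.ne
  have hrn : ∀ n : ℕ, 0 < r₀ / K ^ n ∧ r₀ / K ^ n ≤ r₀ := fun n =>
    ⟨by positivity, div_le_self hr0.le (one_le_pow₀ hK.le)⟩
  have hdecay : ∀ n : ℕ, (2 * K ^ d) ^ n * ρ.real (closedBall x₀ (r₀ / K ^ n)) ≤
      ρ.real (closedBall x₀ r₀) := by
    intro n
    induction n with
    | zero => simp
    | succ n ih =>
      have h1 := hcon (r₀ / K ^ (n + 1)) (hrn _).1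
        ((hrn _).2.trans_lt (hlt.trans_le (min_le_left _ _)))
      have h2 : K * (r₀ / K ^ (n + 1)) = r₀ / K ^ n := by
        rw [pow_succ]; field_simp
      rw [h2] at h1
      refine le_trans ?_ ih
      rw [pow_succ, mul_assoc]
      gcongr
  have hgrow : ∀ n : ℕ, v * r₀ ^ d * 2 ^ n ≤ ρ.real (closedBall x₀ r₀) := by
    intro n
    have h1 := hv ⟨(hrn n).1, (hrn n).2.trans_lt (hlt.trans_le (min_le_right _ _))⟩
    rw [Measure.addHaar_real_closedBall _ _ (hrn n).1.le, finrank_euclideanSpace_fin] at h1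
    calc v * r₀ ^ d * 2 ^ n = (2 * K ^ d) ^ n * ((r₀ / K ^ n) ^ d * v) := by
          have h2 : (K ^ n) ^ d = (K ^ d) ^ n := by rw [← pow_mul, ← pow_mul, mul_comm]
          have h3 : (K ^ d) ^ n ≠ 0 := by positivity
          clear_value r₀
          rw [mul_pow, div_pow, h2]
          field_simp
      _ ≤ _ := (mul_le_mul_of_nonneg_left h1 (by positivity)).trans (hdecay n)
  obtain ⟨n, hn⟩ := pow_unbounded_of_one_lt (ρ.real (closedBall x₀ r₀) / (v * r₀ ^ d))
    (one_lt_two (α := ℝ))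
  rw [div_lt_iff₀ (by positivity)] at hn
  linarith [hgrow n]

/-- At a point where `ρ` is asymptotically singular and `f` is approximately continuous, the value
of `f` is a symmetrized tensor product. -/
theorem exists_symmetrized_product_of_saint_venant {Ω : Set (Euc d)} (hΩ : IsOpen Ω)
    {ρ : Measure (Euc d)} [IsFiniteMeasure ρ] {f : Euc d → Matrix (Fin d) (Fin d) ℝ}
    (hf : ∀ i j, Integrable (fun x => f x i j) ρ) (hbd : ∀ᵐ x ∂ρ, ∀ i j, |f x i j| ≤ 1)
    (hsv : ∀ φ : Euc d → ℝ, IsTest φ → tsupport φ ⊆ Ω → ∀ a b : Euc d,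
      ∫ x, (dd a (dd a φ) x * form (f x) b b + dd b (dd b φ) x * form (f x) a a -
        2 * (dd a (dd b φ) x * form (f x) a b)) ∂ρ = 0)
    {N : Set (Euc d)} (hN : MeasurableSet N) (hN0 : volume N = 0) {x₀ : Euc d} (hx₀ : x₀ ∈ Ω)
    {P : Matrix (Fin d) (Fin d) ℝ} (hPs : P.IsSymm) (hP0 : P ≠ 0)
    (hvol : ∀ᶠ r in 𝓝[>] 0, volume.real (closedBall x₀ r) ≤ ρ.real (closedBall x₀ r))
    (hsing : ∀ ε > 0, ∀ᶠ r in 𝓝[>] 0,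
      ρ.real (closedBall x₀ r \ N) ≤ ε * ρ.real (closedBall x₀ r))
    (hleb : ∀ ε > 0, ∀ᶠ r in 𝓝[>] 0,
      ∫ x in closedBall x₀ r, (∑ i, ∑ j, |f x i j - P i j|) ∂ρ ≤ ε * ρ.real (closedBall x₀ r)) :
    ∃ a b : Fin d → ℝ, a ≠ 0 ∧ b ≠ 0 ∧ ∀ i j, P i j = (a i * b j + b i * a j) / 2 := by
  by_contra hP
  obtain ⟨hd, T, C, hC, hell⟩ := exists_elliptic_equation hPs hP0 hP
  set t : ℝ := ‖(T : Euc d →L[ℝ] Euc d)‖ + 1 with ht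
  set t' : ℝ := ‖(T.symm : Euc d →L[ℝ] Euc d)‖ + 1 with ht'
  have ht1 : 1 ≤ t := by linarith [norm_nonneg (T : Euc d →L[ℝ] Euc d)]
  have ht1' : 1 ≤ t' := by linarith [norm_nonneg (T.symm : Euc d →L[ℝ] Euc d)]
  set K : ℝ := 2 * t * t' with hK
  have hK1 : 1 < K := by nlinarith
  have hK0 : 0 < K := one_pos.trans hK1
  set g : Euc d → ℝ := fun x => ∑ i, ∑ j, |f x i j - P i j| with hg
  set B : ℝ := ∑ i, ∑ j, (1 + |P i j|) with hB
  set M : ℝ := max (2 * K ^ d) (C * B) with hM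
  have hM0 : 0 < M := lt_max_of_lt_left (by positivity)
  obtain ⟨ε, hε, H⟩ := not_almost_harmonic_singular hd hM0
  have hgi : Integrable g ρ := integrable_finsetSum _ fun i _ => integrable_finsetSum _ fun j _ =>
    ((hf i j).sub (integrable_const _)).abs
  have hg0 : ∀ x, 0 ≤ g x := fun x => Finset.sum_nonneg fun i _ => Finset.sum_nonneg fun j _ =>
    abs_nonneg _
  set η : ℝ := ε / ((C + 1) * (2 * K ^ d)) with hη
  have hη0 : 0 < η := by positivity
  have hηε : η * (2 * K ^ d) ≤ ε := by
    rw [hη, ← div_div, div_mul_cancel₀ _ (by positivity)]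
    exact div_le_self hε.le (by linarith)
  have hηC : C * (η * (2 * K ^ d)) ≤ ε := by
    rw [hη, ← div_div, div_mul_cancel₀ _ (by positivity), mul_div_assoc',
      div_le_iff₀ (by positivity)]
    nlinarith
  have hball : ∀ᶠ r in 𝓝[>] (0 : ℝ), closedBall x₀ r ⊆ Ω := by
    obtain ⟨s, hs, hsub⟩ := Metric.isOpen_iff.1 hΩ x₀ hx₀
    filter_upwards [Ioo_mem_nhdsGT hs] with r hr
    exact (closedBall_subset_ball hr.2).trans hsub
  obtain ⟨δ₁, hδ₁, H1⟩ := (nhdsGT_basis (0 : ℝ)).eventually_iff.1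
    (hvol.and ((hsing η hη0).and ((hleb η hη0).and hball)))
  obtain ⟨R, hR0, hRδ, hdoub⟩ := exists_doubling_radius hvol hK1 (show 0 < δ₁ / K by positivity)
  have hKR : K * R < δ₁ := by rwa [lt_div_iff₀' hK0] at hRδ
  obtain ⟨-, h_sing, h_leb, h_ball⟩ := H1 ⟨by positivity, hKR⟩
  have h_vol := (H1 ⟨hR0, lt_of_le_of_lt (by nlinarith) hKR⟩).1
  have hmR : 0 < ρ.real (closedBall x₀ R) :=
    (ENNReal.toReal_pos (measure_closedBall_pos _ _ hR0).ne'
      measure_closedBall_lt_top.ne).trans_le h_vol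
  set r : ℝ := t * R with hr
  have hr0 : 0 < r := by positivity
  set S := blowup T x₀ hr0.ne' with hS
  have hS1 : closedBall x₀ R ⊆ S ⁻¹' closedBall 0 1 := by
    intro x hx
    rw [mem_preimage, mem_closedBall_zero_iff, hS, blowup_apply, norm_smul, norm_inv,
      Real.norm_of_nonneg hr0.le, inv_mul_le_iff₀ hr0, mul_one, hr]
    rw [mem_closedBall, dist_eq_norm] at hx
    exact ((T : Euc d →L[ℝ] Euc d).le_opNorm _).trans
      (mul_le_mul (by linarith) hx (norm_nonneg _) (by positivity))
  have hS2 : S ⁻¹' closedBall 0 2 ⊆ closedBall x₀ (K * R) := by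
    intro x hx
    rw [mem_preimage, mem_closedBall_zero_iff, hS, blowup_apply, norm_smul, norm_inv,
      Real.norm_of_nonneg hr0.le, inv_mul_le_iff₀ hr0] at hx
    rw [mem_closedBall, dist_eq_norm]
    calc ‖x - x₀‖ = ‖T.symm (T (x - x₀))‖ := by rw [T.symm_apply_apply]
      _ ≤ ‖(T.symm : Euc d →L[ℝ] Euc d)‖ * ‖T (x - x₀)‖ :=
        (T.symm : Euc d →L[ℝ] Euc d).le_opNorm _
      _ ≤ t' * (r * 2) := mul_le_mul (by linarith) hx (norm_nonneg _) (by positivity)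
      _ = K * R := by rw [hK, hr]; ring
  set A := S ⁻¹' closedBall 0 2 with hA
  have hAm : MeasurableSet A := S.continuous.measurable isClosed_closedBall.measurableSet
  set ν := (ρ.restrict A).map S.toMeasurableEquiv with hν
  have hνa : ∀ s, ν s = ρ (S ⁻¹' s ∩ A) := by
    intro s
    rw [hν, MeasurableEquiv.map_apply, Measure.restrict_apply' hAm]
    rfl
  have hνr : ∀ s, ν.real s = ρ.real (S ⁻¹' s ∩ A) := fun s => by
    simp only [Measure.real, hνa]
  have : IsFiniteMeasure ν := by rw [hν]; infer_instance
  have hνi : ∀ h : Euc d → ℝ, ∫ y, h y ∂ν = ∫ x in A, h (S x) ∂ρ := fun h =>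
    integral_map_equiv S.toMeasurableEquiv h
  have hν1 : ρ.real (closedBall x₀ R) ≤ ν.real (closedBall 0 1) := by
    rw [hνr]
    exact measureReal_mono (subset_inter hS1 (hS1.trans (preimage_mono
      (closedBall_subset_closedBall one_le_two))))
  have hKm : ρ.real (closedBall x₀ (K * R)) ≤ 2 * K ^ d * ν.real (closedBall 0 1) :=
    hdoub.trans (by gcongr)
  have hGcomp : ∀ x, C * g (S.symm (S x)) = C * g x := fun x => by rw [S.symm_apply_apply]
  refine H ν (fun y => C * g (S.symm y)) (S.symm ⁻¹' N) (S.symm.continuous.measurable hN) ?_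
    (hmR.trans_le hν1) ?_ ?_ ?_ ?_ (fun y => mul_nonneg hC (hg0 _)) ?_ ?_ ?_
  · have : S.symm ⁻¹' N = S '' N := (S.toEquiv.image_eq_preimage_symm N).symm
    rw [this]
    exact addHaar_image_eq_zero_of_differentiableOn_of_addHaar_eq_zero _
      (fun x _ => (hasFDerivAt_blowup T x₀ hr0.ne' x).differentiableAt.differentiableWithinAt) hN0
  · rw [hνa, hA, ← preimage_inter, compl_inter_self, preimage_empty, measure_empty]
  · rw [hνr, preimage_univ, univ_inter]
    exact (measureReal_mono hS2).trans (hKm.trans (by gcongr; exact le_max_left _ _))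
  · rw [hνr, ← preimage_compl, ← preimage_comp, S.symm_comp_self, preimage_id]
    calc ρ.real (Nᶜ ∩ A) ≤ ρ.real (closedBall x₀ (K * R) \ N) :=
          measureReal_mono fun x hx => ⟨hS2 hx.2, hx.1⟩
      _ ≤ η * (2 * K ^ d * ν.real (closedBall 0 1)) := h_sing.trans (by gcongr)
      _ = η * (2 * K ^ d) * ν.real (closedBall 0 1) := by ring
      _ ≤ _ := by gcongr
  · refine AEStronglyMeasurable.const_mul ?_ C
    rw [hν]
    refine (S.toMeasurableEquiv.measurableEmbedding.aestronglyMeasurable_map_iff).2 ?_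
    have : (fun y => g (S.symm y)) ∘ S.toMeasurableEquiv = g := by
      funext x; exact congrArg g (S.symm_apply_apply x)
    rw [this]
    exact hgi.aestronglyMeasurable.restrict
  · rw [hν, S.toMeasurableEquiv.measurableEmbedding.ae_map_iff]
    filter_upwards [ae_restrict_of_ae hbd] with x hx
    have h1 : g x ≤ B := Finset.sum_le_sum fun i _ => Finset.sum_le_sum fun j _ =>
      (abs_sub _ _).trans (by linarith [hx i j])
    calc C * g (S.symm (S x)) = C * g x := hGcomp x
      _ ≤ C * B := by gcongr
      _ ≤ M := le_max_right _ _
  · rw [hνi]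
    simp only [hGcomp]
    rw [integral_const_mul]
    calc C * ∫ x in A, g x ∂ρ ≤ C * ∫ x in closedBall x₀ (K * R), g x ∂ρ := by
          exact mul_le_mul_of_nonneg_left (setIntegral_mono_set hgi.integrableOn
            (Eventually.of_forall hg0) hS2.eventuallyLE) hC
      _ ≤ C * (η * (2 * K ^ d * ν.real (closedBall 0 1))) := by
          gcongr; exact h_leb.trans (by gcongr)
      _ = C * (η * (2 * K ^ d)) * ν.real (closedBall 0 1) := by ring
      _ ≤ _ := by gcongr
  · intro ψ hψ hψs
    have hφ := hψ.comp_blowup T x₀ hr0.ne'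
    have hsub : tsupport (ψ ∘ S) ⊆ A := by
      rw [tsupport_comp_eq_preimage]
      exact preimage_mono (hψs.trans ball_subset_closedBall)
    have h1 := hell ρ f hf _ hφ (hsv _ hφ (hsub.trans (hS2.trans h_ball)))
    have hz : ∀ v w : Euc d, ∀ x ∉ A, dd v (dd w ψ) (S x) = 0 := by
      intro v w x hx
      by_contra hne
      exact hx (preimage_mono (f := S) (((subset_tsupport _).trans ((tsupport_dd_subset _ _).trans
        ((tsupport_dd_subset _ _).trans hψs))).trans ball_subset_closedBall) hne)
    simp only [lap]
    rw [hνi, hνi, setIntegral_eq_integral_of_forall_compl_eq_zero fun x hx =>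
        Finset.sum_eq_zero fun i _ => hz _ _ x hx,
      setIntegral_eq_integral_of_forall_compl_eq_zero fun x hx => by simp [hz _ _ x hx]]
    simp only [dd_dd_comp_blowup hψ, ← Finset.mul_sum, abs_mul, abs_of_nonneg (sq_nonneg r⁻¹),
      mul_left_comm _ (r⁻¹ ^ 2), integral_const_mul] at h1
    simp only [hGcomp]
    exact le_of_mul_le_mul_left h1 (by positivity)

theorem eventually_measureReal_le_mul {μ σ ρ : Measure (Euc d)} [IsLocallyFiniteMeasure μ]
    [IsFiniteMeasure ρ] (hσ : σ ≤ ρ) {x : Euc d}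
    (h : Tendsto (fun r => μ (closedBall x r) / σ (closedBall x r)) (𝓝[>] 0) (𝓝 0))
    {ε : ℝ} (hε : 0 < ε) :
    ∀ᶠ r in 𝓝[>] 0, μ.real (closedBall x r) ≤ ε * ρ.real (closedBall x r) := by
  filter_upwards [h.eventually_lt_const (ENNReal.ofReal_pos.2 hε)] with r hr
  have hfin : σ (closedBall x r) ≠ ⊤ := ((hσ _).trans_lt (measure_lt_top _ _)).ne
  have h1 : μ (closedBall x r) ≤ ENNReal.ofReal ε * ρ (closedBall x r) :=
    ((ENNReal.div_le_iff_le_mul (Or.inr ENNReal.ofReal_ne_top) (Or.inl hfin)).1 hr.le).trans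
      (by gcongr)
  have h2 := ENNReal.toReal_mono (ENNReal.mul_ne_top ENNReal.ofReal_ne_top (measure_ne_top _ _)) h1
  rwa [ENNReal.toReal_mul, ENNReal.toReal_ofReal hε.le] at h2

/-- Almost every point is a Lebesgue point of a matrix-valued integrable function. -/
theorem ae_lebesgue_point {ρ : Measure (Euc d)} [IsFiniteMeasure ρ]
    {f : Euc d → Matrix (Fin d) (Fin d) ℝ} (hf : ∀ i j, Integrable (fun x => f x i j) ρ) :
    ∀ᵐ x₀ ∂ρ, ∀ ε > 0, ∀ᶠ r in 𝓝[>] 0,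
      ∫ x in closedBall x₀ r, (∑ i, ∑ j, |f x i j - f x₀ i j|) ∂ρ ≤
        ε * ρ.real (closedBall x₀ r) := by
  have h := ae_all_iff.2 fun i => ae_all_iff.2 fun j =>
    (Besicovitch.vitaliFamily ρ).ae_tendsto_average_norm_sub (hf i j).locallyIntegrable
  filter_upwards [h] with x₀ hx ε hε
  have h1 : Tendsto (fun r => ∑ i, ∑ j, ⨍ y in closedBall x₀ r, ‖f y i j - f x₀ i j‖ ∂ρ)
      (𝓝[>] 0) (𝓝 (∑ _i : Fin d, ∑ _j : Fin d, 0)) :=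
    tendsto_finsetSum _ fun i _ => tendsto_finsetSum _ fun j _ =>
      (hx i j).comp (Besicovitch.tendsto_filterAt ρ x₀)
  simp only [Finset.sum_const_zero] at h1
  filter_upwards [h1.eventually_lt_const hε] with r hr
  have hi : ∀ i j, Integrable (fun x => |f x i j - f x₀ i j|) (ρ.restrict (closedBall x₀ r)) :=
    fun i j => ((hf i j).sub (integrable_const _)).abs.restrict
  rw [integral_finsetSum _ fun i _ => integrable_finsetSum _ fun j _ => hi i j]
  simp only [integral_finsetSum _ fun j _ => hi _ j]
  simp only [setAverage_eq, smul_eq_mul, Real.norm_eq_abs, ← Finset.mul_sum] at hr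
  rcases (measureReal_nonneg (μ := ρ) (s := closedBall x₀ r)).eq_or_lt with h0 | h0
  · have hz : ρ.restrict (closedBall x₀ r) = 0 :=
      Measure.restrict_eq_zero.2 ((measureReal_eq_zero_iff).1 h0.symm)
    simp [hz, ← h0]
  · rw [inv_mul_lt_iff₀ h0] at hr
    linarith

end BDRankOne

/-- **Rank-one theorem in BD.**
Let `u ∈ BD(Ω)`: `u ∈ L¹(Ω; ℝ^d)` and the symmetric part of its distributional
derivative is the finite `ℝ^{d×d}_sym`-valued Radon measure `Eu = f·ρ`, represented by
`ρ = |Eu|` (finite, positive, concentrated on `Ω`) and the polar `f = d(Eu)/d|Eu|`,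
which is symmetric-matrix valued with (Frobenius) norm one `ρ`-a.e.  Then at
`|E^s u|`-a.e. point the polar equals a symmetrized tensor product
`a ⊙ b = (a⊗b + b⊗a)/2` with `a, b ≠ 0`. -/
theorem statement4 {d : ℕ}
    (Ω : Set (EuclideanSpace ℝ (Fin d))) (hΩ : IsOpen Ω)
    (u : EuclideanSpace ℝ (Fin d) → EuclideanSpace ℝ (Fin d))
    (hu : IntegrableOn u Ω volume)
    (ρ : Measure (EuclideanSpace ℝ (Fin d))) [IsFiniteMeasure ρ]
    (hρΩ : ρ Ωᶜ = 0)
    (f : EuclideanSpace ℝ (Fin d) → Matrix (Fin d) (Fin d) ℝ)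
    (hf : AEStronglyMeasurable f ρ)
    (hfsymm : ∀ x, (f x).IsSymm)
    (hpolar : ∀ᵐ x ∂ρ, ∑ i, ∑ j, (f x i j) ^ 2 = 1)
    (hEu : ∀ φ : EuclideanSpace ℝ (Fin d) → ℝ,
      ContDiff ℝ (⊤ : ℕ∞) φ → HasCompactSupport φ → tsupport φ ⊆ Ω →
      ∀ i j : Fin d,
        ∫ x in Ω, (u x i * pderiv' j φ x + u x j * pderiv' i φ x) / 2 ∂volume
          = - ∫ x, φ x * f x i j ∂ρ) :
    ∀ᵐ x ∂(ρ.singularPart volume),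
      ∃ a b : Fin d → ℝ, a ≠ 0 ∧ b ≠ 0 ∧
        ∀ i j : Fin d, f x i j = (a i * b j + b i * a j) / 2 := by
  have hbd : ∀ᵐ x ∂ρ, ∀ i j, |f x i j| ≤ 1 := by
    filter_upwards [hpolar] with x hx i j
    have h1 : f x i j ^ 2 ≤ 1 := hx ▸
      (Finset.single_le_sum (f := fun j => f x i j ^ 2) (fun j _ => sq_nonneg _)
        (Finset.mem_univ j)).trans
      (Finset.single_le_sum (f := fun i => ∑ j, f x i j ^ 2)
        (fun i _ => Finset.sum_nonneg fun j _ => sq_nonneg _) (Finset.mem_univ i))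
    exact (sq_le_one_iff_abs_le_one _).1 h1
  have hfi : ∀ i j, Integrable (fun x => f x i j) ρ := fun i j =>
    Integrable.of_bound (((continuous_id.matrix_elem i j).comp_aestronglyMeasurable hf)) 1
      (by filter_upwards [hbd] with x hx using hx i j)
  have hui : ∀ i, IntegrableOn (fun x => u x i) Ω volume := fun i =>
    (EuclideanSpace.proj (𝕜 := ℝ) i : EuclideanSpace ℝ (Fin d) →L[ℝ] ℝ).integrable_comp hu
  have hsv := fun (φ : BDRankOne.Euc d → ℝ) (hφ : BDRankOne.IsTest φ) (hs : tsupport φ ⊆ Ω) =>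
    BDRankOne.saint_venant hui hfi (fun φ hφ hs => hEu φ hφ.1 hφ.2 hs) hφ hs
  set σ := ρ.singularPart volume with hσ
  have hσρ : σ ≤ ρ := Measure.singularPart_le _ _
  have hac : σ ≪ ρ := Measure.absolutelyContinuous_of_le hσρ
  have hms : σ ⟂ₘ (volume : Measure (BDRankOne.Euc d)) := Measure.mutuallySingular_singularPart _ _
  have : IsFiniteMeasure σ := by rw [hσ]; infer_instance
  set N := hms.nullSetᶜ with hN
  have hNm : MeasurableSet N := hms.measurableSet_nullSet.compl
  have hsing : ρ.restrict Nᶜ ⟂ₘ σ := by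
    refine ⟨N, hNm, ?_, ?_⟩
    · rw [Measure.restrict_apply hNm, Set.inter_compl_self, measure_empty]
    · rw [hN, compl_compl, hms.measure_nullSet]
  filter_upwards [hac.ae_le hpolar, hac.ae_le (BDRankOne.ae_lebesgue_point hfi),
    hac.ae_le (mem_ae_iff.2 hρΩ : ∀ᵐ x ∂ρ, x ∈ Ω), BDRankOne.ae_tendsto_ratio_zero hsing,
    BDRankOne.ae_tendsto_ratio_zero hms.symm] with x hx hleb hxΩ h1 h2
  refine BDRankOne.exists_symmetrized_product_of_saint_venant hΩ hfi hbd hsv hNm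
    hms.measure_compl_nullSet hxΩ (hfsymm x) ?_ ?_ ?_ hleb
  · intro h0
    simp [h0] at hx
  · simpa using BDRankOne.eventually_measureReal_le_mul hσρ h2 one_pos
  · intro ε hε
    filter_upwards [BDRankOne.eventually_measureReal_le_mul hσρ h1 hε] with r hr
    rwa [measureReal_restrict_apply isClosed_closedBall.measurableSet, ← Set.sdiff_eq] at hr
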